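/- arXiv:1402.2558 — 2 statements merged into one kernel-verified Lean document; each statement's English description precedes it below -/
import Mathlib

section
/- Suppose condition (B_p) holds for some p > 1 and condition (Q_∞) holds. Then there exists a Markov chain (X_n,η_n,η*_n) on ℤ≥0 × S × S such that: (i) (X_n,η_n) is a Markov chain on ℤ≥0 × S with transition probabilities p(x,i,y,j); (ii) (η*_n) is a Markov chain on S with transition probabilities q(i,j); and (iii) for all n ∈ ℤ≥0 and all i ∈ S, lim_{x→∞} P[η_k = η*_k for all 0 ≤ k ≤ n | X_0 = x, η_0 = η*_0 = i] = 1. If in addition condition (Q_∞^+) holds, then there exists δ > 0 such that for any A < ∞ and all i ∈ S, as x → ∞, 1 − P[η_k = η*_k for all 0 ≤ k ≤ A log x | X_0 = x, η_0 = η*_0 = i] = O(x^{−δ}). -/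
open MeasureTheory Filter Topology Asymptotics
open scoped ENNReal NNReal

/-- A time-homogeneous Markov chain on a measurable state space `E`, encoded via the family
`P z` of laws (on trajectory space) of the chain started at `z`.  The field `markov` is the
time-homogeneous Markov property: conditionally on the event `{ω n = w}` intersected with any
event `B` depending only on the first `n+1` coordinates, the shifted trajectory has law `P w`. -/
structure MChain (E : Type*) [MeasurableSpace E] where
  P : E → MeasureTheory.Measure (ℕ → E)
  isProb : ∀ z, MeasureTheory.IsProbabilityMeasure (P z)
  init : ∀ z, P z {ω | ω 0 = z} = 1
  markov : ∀ (z : E) (n : ℕ) (w : E) (A B : Set (ℕ → E)), MeasurableSet A →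
    (∀ ω ω' : ℕ → E, (∀ k, k ≤ n → ω k = ω' k) → ω ∈ B → ω' ∈ B) →
    P z (B ∩ {ω | ω n = w} ∩ {ω | (fun k => ω (n + k)) ∈ A})
      = P z (B ∩ {ω | ω n = w}) * P w A

namespace MChain

variable {E : Type*} [MeasurableSpace E]

/-- Irreducibility: every state can be reached from every state with positive probability. -/
def Irreducible (X : MChain E) : Prop := ∀ z w : E, ∃ n : ℕ, X.P z {ω | ω n = w} ≠ 0

/-- Recurrence: from every state, the chain returns to it almost surely. -/
def Recurrent (X : MChain E) : Prop := ∀ z : E, X.P z {ω | ∃ n, 1 ≤ n ∧ ω n = z} = 1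

def Transient (X : MChain E) : Prop := ¬ X.Recurrent

/-- The first return time to `z` (with junk value `0`, via `sInf ∅ = 0`, if there is no return). -/
noncomputable def returnTime (z : E) (ω : ℕ → E) : ℕ := sInf {n | 1 ≤ n ∧ ω n = z}

/-- Positive recurrence: recurrent, with finite mean return times. -/
def PositiveRecurrent (X : MChain E) : Prop :=
  X.Recurrent ∧ ∀ z : E, (∫⁻ ω, (returnTime z ω : ℝ≥0∞) ∂(X.P z)) ≠ ⊤

def NullRecurrent (X : MChain E) : Prop := X.Recurrent ∧ ¬ X.PositiveRecurrent

end MChain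

section HalfStrip

variable {S : Type*} [Fintype S] [DecidableEq S] [Nonempty S]
  [MeasurableSpace S] [MeasurableSingletonClass S]

/-- `qhat X x i j` is the probability that the `S`-coordinate moves from `i` to `j` when the
`ℕ`-coordinate is at `x`; this is `q_x(i,j) = Σ_y p(x,i,y,j)` of the paper. -/
noncomputable def qhat (X : MChain (ℕ × S)) (x : ℕ) (i j : S) : ℝ :=
  (X.P (x, i) {ω | (ω 1).2 = j}).toReal

/-- `stepMoment X k x i = μ_k(x,i) = E[(X_{n+1}-X_n)^k | X_n = x, η_n = i]`. -/
noncomputable def stepMoment (X : MChain (ℕ × S)) (k : ℕ) (x : ℕ) (i : S) : ℝ :=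
  ∫ ω, (((ω 1).1 : ℝ) - (x : ℝ)) ^ k ∂(X.P (x, i))

/-- Condition (B_p): uniformly bounded conditional `p`-th moments of the jumps of the
`ℕ`-coordinate (by the Markov property, the conditional moment given `F_n` is a function of
the current state only). -/
def CondB (X : MChain (ℕ × S)) (p : ℝ) : Prop :=
  ∃ C : ℝ≥0∞, C ≠ ⊤ ∧ ∀ (x : ℕ) (i : S),
    (∫⁻ ω, ENNReal.ofReal (|((ω 1).1 : ℝ) - (x : ℝ)| ^ p) ∂(X.P (x, i))) ≤ C

def IsStochasticMatrix (Q : S → S → ℝ) : Prop :=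
  (∀ i j, 0 ≤ Q i j) ∧ ∀ i, (∑ j, Q i j) = 1

def IsIrreducibleMatrix (Q : S → S → ℝ) : Prop :=
  ∀ i j, ∃ n : ℕ, 0 < ((Matrix.of Q) ^ n) i j

/-- Aperiodicity (for a finite irreducible stochastic matrix, eventual positivity of the
diagonal entries of the powers is equivalent to aperiodicity). -/
def IsAperiodicMatrix (Q : S → S → ℝ) : Prop :=
  ∀ i, ∃ N : ℕ, ∀ n, N ≤ n → 0 < ((Matrix.of Q) ^ n) i i

/-- `pst` is a (strictly positive) stationary distribution for `Q`. -/
def IsStationaryDist (Q : S → S → ℝ) (pst : S → ℝ) : Prop :=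
  (∀ i, 0 < pst i) ∧ (∑ i, pst i) = 1 ∧ ∀ j, (∑ i, pst i * Q i j) = pst j

/-- Condition (Q_∞): the transition matrix of the `S`-coordinate converges as `x → ∞` to an
irreducible stochastic matrix `Q`. -/
def CondQ (X : MChain (ℕ × S)) (Q : S → S → ℝ) : Prop :=
  (∀ i j, Tendsto (fun x : ℕ => qhat X x i j) atTop (nhds (Q i j))) ∧
    IsStochasticMatrix Q ∧ IsIrreducibleMatrix Q

/-- Condition (Q_∞^+): as (Q_∞), with a power-law rate of convergence. -/
def CondQplus (X : MChain (ℕ × S)) (Q : S → S → ℝ) : Prop :=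
  (∃ δ₀ : ℝ, 0 < δ₀ ∧ ∀ i j,
      (fun x : ℕ => qhat X x i j - Q i j) =O[atTop] fun x : ℕ => (x : ℝ) ^ (-δ₀)) ∧
    IsStochasticMatrix Q ∧ IsIrreducibleMatrix Q

/-- Condition (M_C): asymptotically constant drifts, `μ₁(x,i) = d_i + o(1)`. -/
def CondMC (X : MChain (ℕ × S)) (d : S → ℝ) : Prop :=
  ∀ i, Tendsto (fun x : ℕ => stepMoment X 1 x i) atTop (nhds (d i))

/-- Condition (M_L): Lamperti-type drifts, `μ₁(x,i) = c_i/x + o(1/x)`, `μ₂(x,i) = s_i² + o(1)`,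
with at least one `s_i²` nonzero. -/
def CondML (X : MChain (ℕ × S)) (c s2 : S → ℝ) : Prop :=
  (∀ i, 0 ≤ s2 i) ∧ (∃ i, s2 i ≠ 0) ∧
    (∀ i, Tendsto (fun x : ℕ => (x : ℝ) * stepMoment X 1 x i) atTop (nhds (c i))) ∧
    (∀ i, Tendsto (fun x : ℕ => stepMoment X 2 x i) atTop (nhds (s2 i)))

/-- Condition (M_L^+): Lamperti-type drifts with power-law error bounds. -/
def CondMLplus (X : MChain (ℕ × S)) (c s2 : S → ℝ) : Prop :=
  (∀ i, 0 ≤ s2 i) ∧ (∃ i, s2 i ≠ 0) ∧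
    ∃ δ₁ : ℝ, 0 < δ₁ ∧ ∀ i,
      ((fun x : ℕ => stepMoment X 1 x i - c i / (x : ℝ)) =O[atTop]
        fun x : ℕ => (x : ℝ) ^ (-1 - δ₁)) ∧
      ((fun x : ℕ => stepMoment X 2 x i - s2 i) =O[atTop] fun x : ℕ => (x : ℝ) ^ (-δ₁))

/-- Successive visit times `τ_0 < τ_1 < ⋯` of the `S`-coordinate to the distinguished state
`s0` (junk value, via `sInf ∅ = 0`, if there is no such visit). -/
noncomputable def tauSeq (s0 : S) (ω : ℕ → ℕ × S) : ℕ → ℕ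
  | 0 => sInf {n | (ω n).2 = s0}
  | m + 1 => sInf {n | tauSeq s0 ω m < n ∧ (ω n).2 = s0}

/-- `τ`, the first positive time at which the `S`-coordinate visits `s0`. -/
noncomputable def tauRet (s0 : S) (ω : ℕ → ℕ × S) : ℕ :=
  sInf {n | 1 ≤ n ∧ (ω n).2 = s0}

/-- `D_n`, the maximal displacement of the `ℕ`-coordinate during the `n`-th excursion. -/
noncomputable def Dexc (s0 : S) (n : ℕ) (ω : ℕ → ℕ × S) : ℕ :=
  Finset.sup (Finset.Icc (tauSeq s0 ω n) (tauSeq s0 ω (n + 1)))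
    fun m => Nat.dist (ω m).1 (ω (tauSeq s0 ω n)).1

/-- `N(n) = max {k : τ_k ≤ n}`. -/
noncomputable def Ncount (s0 : S) (n : ℕ) (ω : ℕ → ℕ × S) : ℕ :=
  sSup {k | tauSeq s0 ω k ≤ n}

end HalfStrip

/-- `Fdist a t` is the distribution function of the square root of a `Gamma(a,t)` random
variable: `F_{a,t}(x) = ∫_0^x 2 u^{2a-1} e^{-u²/t} / (t^a Γ(a)) du`. -/
noncomputable def Fdist (a t x : ℝ) : ℝ :=
  ∫ u in (0:ℝ)..x, 2 * u ^ (2 * a - 1) * Real.exp (-(u ^ 2) / t) / (t ^ a * Real.Gamma a)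

variable {S : Type*} [Fintype S] [DecidableEq S] [Nonempty S]
  [MeasurableSpace S] [MeasurableSingletonClass S]

section PathMeasure

variable {E : Type*} [MeasurableSpace E] [Countable E] [MeasurableSingletonClass E]

/-- A set of trajectories is determined by the coordinates up to time `n`. -/
def DeterminedUpTo (n : ℕ) (B : Set (ℕ → E)) : Prop :=
  ∀ ω ω' : ℕ → E, (∀ k, k ≤ n → ω k = ω' k) → ω ∈ B → ω' ∈ B

omit [MeasurableSpace E] [Countable E] [MeasurableSingletonClass E] in
theorem DeterminedUpTo.eq_preimage {n : ℕ} {B : Set (ℕ → E)} (hB : DeterminedUpTo n B) :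
    B = (Finset.Iic n).restrict ⁻¹' ((Finset.Iic n).restrict '' B) := by
  refine (Set.subset_preimage_image _ _).antisymm ?_
  rintro ω ⟨ω', hω', h⟩
  exact hB ω' ω (fun k hk => congrFun h ⟨k, Finset.mem_Iic.2 hk⟩) hω'

theorem DeterminedUpTo.measurableSet {n : ℕ} {B : Set (ℕ → E)} (hB : DeterminedUpTo n B) :
    MeasurableSet B := by
  rw [hB.eq_preimage]
  exact (Finset.measurable_restrict _) (Set.to_countable _).measurableSet

theorem measurableSet_coord_eq (n : ℕ) (w : E) : MeasurableSet {ω : ℕ → E | ω n = w} :=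
  DeterminedUpTo.measurableSet (n := n) fun _ _ h hω => (h n le_rfl).symm.trans hω

theorem measurableSet_coord_mem (n : ℕ) (U : Set E) : MeasurableSet {ω : ℕ → E | ω n ∈ U} :=
  DeterminedUpTo.measurableSet (n := n) fun ω ω' h (hω : ω n ∈ U) =>
    show ω' n ∈ U from h n le_rfl ▸ hω

/-- The trajectory started at `z` driven by the family of random maps `F (n, ·)`. -/
def drivenPath (z : E) (F : ℕ × E → E) : ℕ → E
  | 0 => z
  | n + 1 => F (n, drivenPath z F n)

omit [MeasurableSpace E] [Countable E] [MeasurableSingletonClass E] in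
theorem drivenPath_add (z : E) (F : ℕ × E → E) (n k : ℕ) :
    drivenPath z F (n + k)
      = drivenPath (drivenPath z F n) (fun q => F (n + q.1, q.2)) k := by
  induction k with
  | zero => rfl
  | succ k ih =>
    change F (n + k, drivenPath z F (n + k)) = F (n + k, _)
    rw [ih]

/-- The `σ`-algebra on driving maps generated by the coordinates with time index in `T`. -/
abbrev drivingSigma (E : Type*) [MeasurableSpace E] (T : Set (ℕ × E)) :
    MeasurableSpace (ℕ × E → E) :=
  ⨆ q ∈ T, MeasurableSpace.comap (fun F : ℕ × E → E => F q) inferInstance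

omit [Countable E] [MeasurableSingletonClass E] in
theorem drivingSigma_le (T : Set (ℕ × E)) :
    drivingSigma E T ≤ (inferInstance : MeasurableSpace (ℕ × E → E)) :=
  iSup₂_le fun q _ => (measurable_pi_apply q).comap_le

omit [Countable E] [MeasurableSingletonClass E] in
theorem measurable_drivingSigma_apply {T : Set (ℕ × E)} {q : ℕ × E} (hq : q ∈ T) :
    Measurable[drivingSigma E T] (fun F : ℕ × E → E => F q) :=
  (comap_measurable _).mono (le_iSup₂_of_le q hq le_rfl) le_rfl

theorem measurable_drivenPath_apply (z : E) (n : ℕ) :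
    Measurable[drivingSigma E {q | q.1 < n}] (fun F => drivenPath z F n) := by
  induction n with
  | zero => exact @measurable_const _ _ _ _ _
  | succ n ih =>
    have ih' : Measurable[drivingSigma E {q | q.1 < n + 1}] (fun F => drivenPath z F n) :=
      ih.mono (biSup_mono fun q hq => Nat.lt_succ_of_lt hq) le_rfl
    refine @measurable_to_countable' _ _ _ _ (drivingSigma E {q | q.1 < n + 1}) _ fun y => ?_
    have : (fun F => drivenPath z F (n + 1)) ⁻¹' {y}
        = ⋃ w : E, (fun F => drivenPath z F n) ⁻¹' {w} ∩ (fun F => F (n, w)) ⁻¹' {y} := by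
      ext F
      simp [drivenPath]
    rw [this]
    refine @MeasurableSet.iUnion _ _ (_) _ _ fun w => @MeasurableSet.inter _ (_) _ _ ?_ ?_
    · exact ih' (measurableSet_singleton w)
    · exact measurable_drivingSigma_apply (by simp) (measurableSet_singleton y)

theorem measurable_drivenPath (z : E) : Measurable (drivenPath z) :=
  measurable_pi_lambda _ fun n =>
    (measurable_drivenPath_apply z n).mono (drivingSigma_le _) le_rfl

/-- The time-homogeneous Markov chain with a prescribed one-step transition kernel on a countable
state space. -/
noncomputable def MChain.ofKernel (K : E → Measure E) [∀ z, IsProbabilityMeasure (K z)] :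
    MChain E where
  P z := (Measure.infinitePi fun q : ℕ × E => K q.2).map (drivenPath z)
  isProb z := Measure.isProbabilityMeasure_map (measurable_drivenPath z).aemeasurable
  init z := by
    rw [Measure.map_apply (measurable_drivenPath z) (measurableSet_coord_eq 0 z)]
    simp [drivenPath]
  markov z n w A B hA hB := by
    have hn : MeasurableSet {ω : ℕ → E | ω n = w} :=
      measurableSet_coord_eq n w
    have hshift : MeasurableSet {ω : ℕ → E | (fun k => ω (n + k)) ∈ A} :=
      (by fun_prop : Measurable fun (ω : ℕ → E) k => ω (n + k)) hA
    have hBm : MeasurableSet B := DeterminedUpTo.measurableSet hB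
    rw [Measure.map_apply (measurable_drivenPath z) ((hBm.inter hn).inter hshift),
      Measure.map_apply (measurable_drivenPath z) (hBm.inter hn),
      Measure.map_apply (measurable_drivenPath w) hA]
    set μ := Measure.infinitePi fun q : ℕ × E => K q.2 with hμ
    set sh : (ℕ × E → E) → (ℕ × E → E) := fun F q => F (n + q.1, q.2) with hsh
    have hinv : μ.map sh = μ :=
      Measure.map_infinitePi_infinitePi_of_inj (P := fun q : ℕ × E => K q.2)
        (f := fun q : ℕ × E => (n + q.1, q.2)) fun a b h => by
          simpa [Prod.ext_iff] using h
    have hshm : Measurable[drivingSigma E {q | n ≤ q.1}] sh := by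
      refine @measurable_pi_lambda _ _ _ (drivingSigma E {q | n ≤ q.1}) _ _ fun q => ?_
      exact measurable_drivingSigma_apply (q := (n + q.1, q.2)) (by simp)
    have hshm' : Measurable sh := hshm.mono (drivingSigma_le _) le_rfl
    have hindep : ProbabilityTheory.Indep (drivingSigma E {q | q.1 < n})
        (drivingSigma E {q | n ≤ q.1}) μ := by
      refine ProbabilityTheory.indep_iSup_of_disjoint
        (fun q => (measurable_pi_apply q).comap_le) ?_ ?_
      · exact (ProbabilityTheory.iIndepFun_infinitePi (P := fun q : ℕ × E => K q.2)
          (X := fun _ x => x) fun _ => measurable_id)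
      · exact Set.disjoint_left.2 fun q (h : q.1 < n) (h' : n ≤ q.1) => absurd h (not_lt.2 h')
    have hpast : MeasurableSet[drivingSigma E {q | q.1 < n}]
        (drivenPath z ⁻¹' (B ∩ {ω | ω n = w})) := by
      have hdet : DeterminedUpTo n (B ∩ {ω | ω n = w}) := fun ω ω' h hω =>
        ⟨hB ω ω' h hω.1, (h n le_rfl).symm.trans hω.2⟩
      rw [hdet.eq_preimage, ← Set.preimage_comp]
      refine @measurable_pi_lambda _ _ _ (drivingSigma E {q | q.1 < n}) _ _ (fun k => ?_) _
        (Set.to_countable _).measurableSet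
      exact (measurable_drivenPath_apply z k).mono
        (biSup_mono fun q hq => lt_of_lt_of_le hq (Finset.mem_Iic.1 k.2)) le_rfl
    have hsplit : drivenPath z ⁻¹' (B ∩ {ω | ω n = w} ∩ {ω | (fun k => ω (n + k)) ∈ A})
        = drivenPath z ⁻¹' (B ∩ {ω | ω n = w}) ∩ sh ⁻¹' (drivenPath w ⁻¹' A) := by
      ext F
      simp only [Set.mem_preimage, Set.mem_inter_iff, Set.mem_ofPred_eq, and_congr_right_iff]
      rintro ⟨-, rfl⟩
      simp only [drivenPath_add, hsh]
    rw [hsplit, (ProbabilityTheory.Indep_iff _ _ μ).1 hindep _ _ hpast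
      (hshm (measurable_drivenPath w hA)), ← Measure.map_apply hshm' (measurable_drivenPath w hA),
      hinv]

theorem MChain.ofKernel_apply_one (K : E → Measure E) [∀ z, IsProbabilityMeasure (K z)]
    (z : E) (U : Set E) : (MChain.ofKernel K).P z {ω | ω 1 ∈ U} = K z U := by
  have hU : MeasurableSet U := (Set.to_countable U).measurableSet
  change Measure.map (drivenPath z) _ _ = _
  rw [Measure.map_apply (measurable_drivenPath z) (measurableSet_coord_mem 1 U)]
  change Measure.infinitePi (fun q : ℕ × E => K q.2) ((fun F => F (0, z)) ⁻¹' U) = _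
  rw [← Measure.map_apply (measurable_pi_apply _) hU, Measure.infinitePi_map_eval]

/-- Probability measures on trajectories in a countable space are determined by the
probabilities of initial segments. -/
theorem ext_of_initial_segments {μ ν : Measure (ℕ → E)} [IsFiniteMeasure μ] [IsFiniteMeasure ν]
    (h : ∀ (n : ℕ) (a : ℕ → E), μ {ω | ∀ k ≤ n, ω k = a k} = ν {ω | ∀ k ≤ n, ω k = a k}) :
    μ = ν := by
  have key : ∀ I : Finset ℕ, μ.map I.restrict = ν.map I.restrict := by
    intro I
    have hI : I ⊆ Finset.Iic (I.sup id) := fun k hk => Finset.mem_Iic.2 (Finset.le_sup (f := id) hk)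
    have hn : μ.map (Finset.Iic (I.sup id)).restrict = ν.map (Finset.Iic (I.sup id)).restrict := by
      refine Measure.ext_of_singleton fun a => ?_
      have hm : Measurable ((Finset.Iic (I.sup id)).restrict (π := fun _ : ℕ => E)) :=
        Finset.measurable_restrict _
      rw [Measure.map_apply hm (measurableSet_singleton a),
        Measure.map_apply hm (measurableSet_singleton a)]
      have hne : Nonempty E := ⟨a ⟨0, by simp⟩⟩
      let b : ℕ → E := fun k =>
        if hk : k ∈ Finset.Iic (I.sup id) then a ⟨k, hk⟩ else hne.some
      have : (Finset.Iic (I.sup id)).restrict (π := fun _ : ℕ => E) ⁻¹' {a}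
          = {ω : ℕ → E | ∀ k ≤ I.sup id, ω k = b k} := by
        ext ω
        simp only [Set.mem_preimage, Set.mem_singleton_iff, Set.mem_ofPred_eq, funext_iff,
          Subtype.forall, Finset.restrict, b]
        refine forall_congr' fun k => ?_
        constructor
        · intro h hk
          rw [dif_pos (Finset.mem_Iic.2 hk)]
          exact h _
        · intro h hk
          have := h (Finset.mem_Iic.1 hk)
          rwa [dif_pos hk] at this
      rw [this]
      exact h _ _
    rw [← Finset.restrict₂_comp_restrict hI, ← Measure.map_map, hn, Measure.map_map]
    all_goals fun_prop
  have : ∀ I : Finset ℕ, IsFiniteMeasure (ν.map I.restrict) := fun I => inferInstance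
  exact IsProjectiveLimit.unique (P := fun I : Finset ℕ => ν.map I.restrict)
    (fun I => key I) (fun I => rfl)

theorem MChain.ae_init (X : MChain E) (z : E) : ∀ᵐ ω ∂(X.P z), ω 0 = z := by
  have := X.isProb z
  exact (prob_compl_eq_zero_iff (measurableSet_coord_eq 0 z)).2 (X.init z)

/-- The Markov property for the event that the next step lands in `U`. -/
theorem MChain.markov_step (X : MChain E) (z : E) (n : ℕ) (w : E) (U : Set E)
    {B : Set (ℕ → E)} (hB : DeterminedUpTo n B) :
    X.P z (B ∩ {ω | ω n = w} ∩ {ω | ω (n + 1) ∈ U})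
      = X.P z (B ∩ {ω | ω n = w}) * X.P w {ω | ω 1 ∈ U} :=
  X.markov z n w {ω | ω 1 ∈ U} B
    (measurableSet_coord_mem 1 U) hB

theorem MChain.measure_eq_tsum (X : MChain E) (z : E) (n : ℕ) {B : Set (ℕ → E)}
    (hB : MeasurableSet B) : X.P z B = ∑' w, X.P z (B ∩ {ω | ω n = w}) := by
  have hm : ∀ w, MeasurableSet {ω : ℕ → E | ω n = w} := fun w =>
    measurableSet_coord_eq n w
  rw [← measure_iUnion ?_ fun w => hB.inter (hm w)]
  · congr 1
    ext ω
    simp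
  · intro w w' hw
    refine Set.disjoint_left.2 ?_
    rintro ω ⟨-, rfl⟩ ⟨-, h⟩
    exact hw h

/-- Decomposition of the probability of a step event according to the present state. -/
theorem MChain.measure_step (X : MChain E) (z : E) (n : ℕ) (U : E → Set E)
    {B : Set (ℕ → E)} (hB : DeterminedUpTo n B) :
    X.P z (B ∩ {ω | ω (n + 1) ∈ U (ω n)})
      = ∑' w, X.P z (B ∩ {ω | ω n = w}) * X.P w {ω | ω 1 ∈ U w} := by
  have hU : MeasurableSet {ω : ℕ → E | ω (n + 1) ∈ U (ω n)} :=
    DeterminedUpTo.measurableSet (n := n + 1) fun ω ω' h hω => by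
      change ω' (n + 1) ∈ U (ω' n)
      rw [← h n n.le_succ, ← h (n + 1) le_rfl]
      exact hω
  rw [X.measure_eq_tsum z n (hB.measurableSet.inter hU)]
  refine tsum_congr fun w => ?_
  rw [← X.markov_step z n w (U w) hB]
  congr 1
  ext ω
  simp only [Set.mem_inter_iff, Set.mem_ofPred_eq]
  constructor
  · rintro ⟨⟨h₁, h₂⟩, rfl⟩
    exact ⟨⟨h₁, rfl⟩, h₂⟩
  · rintro ⟨⟨h₁, rfl⟩, h₂⟩
    exact ⟨⟨h₁, h₂⟩, rfl⟩

/-- If, on an event `B` determined up to time `n`, the conditional probability of a step event is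
constant, it factors out. -/
theorem MChain.measure_step_eq (X : MChain E) (z : E) (n : ℕ) (U : E → Set E) (c : ℝ≥0∞)
    {B : Set (ℕ → E)} (hB : DeterminedUpTo n B)
    (hc : ∀ ω ∈ B, X.P (ω n) {ω' | ω' 1 ∈ U (ω n)} = c) :
    X.P z (B ∩ {ω | ω (n + 1) ∈ U (ω n)}) = X.P z B * c := by
  rw [X.measure_step z n U hB, X.measure_eq_tsum z n hB.measurableSet, ← ENNReal.tsum_mul_right]
  refine tsum_congr fun w => ?_
  rcases (B ∩ {ω | ω n = w}).eq_empty_or_nonempty with h | ⟨ω, hω, rfl⟩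
  · simp [h]
  · rw [hc ω hω]

/-- A bound on the conditional probability of a step event, valid on an event `B` determined up to
time `n`, bounds its probability on `B`. -/
theorem MChain.measure_step_le (X : MChain E) (z : E) (n : ℕ) (U : E → Set E) (c : ℝ≥0∞)
    {B : Set (ℕ → E)} (hB : DeterminedUpTo n B)
    (hc : ∀ ω ∈ B, X.P (ω n) {ω' | ω' 1 ∈ U (ω n)} ≤ c) :
    X.P z (B ∩ {ω | ω (n + 1) ∈ U (ω n)}) ≤ c := by
  have := X.isProb z
  calc X.P z (B ∩ {ω | ω (n + 1) ∈ U (ω n)})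
      ≤ X.P z B * c := by
        rw [X.measure_step z n U hB, X.measure_eq_tsum z n hB.measurableSet,
          ← ENNReal.tsum_mul_right]
        refine ENNReal.tsum_le_tsum fun w => ?_
        rcases (B ∩ {ω | ω n = w}).eq_empty_or_nonempty with h | ⟨ω, hω, rfl⟩
        · simp [h]
        · gcongr
          exact hc ω hω
    _ ≤ 1 * c := by gcongr; exact prob_le_one
    _ = c := one_mul c

/-- If the one-step transitions of `R` project under `f` to those of `X`, then so do the laws of
the trajectories. -/
theorem MChain.map_eq_of_step {E' : Type*} [MeasurableSpace E'] [Countable E']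
    [MeasurableSingletonClass E'] (R : MChain E) (X : MChain E') (f : E → E')
    (hf : ∀ z b, R.P z {ω | f (ω 1) = b} = X.P (f z) {ω | ω 1 = b}) (z : E) :
    (R.P z).map (fun ω n => f (ω n)) = X.P (f z) := by
  have := R.isProb z
  have := X.isProb (f z)
  have hfm : Measurable f := Measurable.of_discrete
  have hm : Measurable fun (ω : ℕ → E) n => f (ω n) :=
    measurable_pi_lambda _ fun n => hfm.comp (measurable_pi_apply n)
  have : IsProbabilityMeasure ((R.P z).map (fun ω n => f (ω n))) :=
    Measure.isProbabilityMeasure_map hm.aemeasurable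
  refine ext_of_initial_segments fun n a => ?_
  have hdX : ∀ n, DeterminedUpTo n {ω : ℕ → E' | ∀ k ≤ n, ω k = a k} :=
    fun n ω ω' h hω k hk => (h k hk).symm.trans (hω k hk)
  have hdR : ∀ n, DeterminedUpTo n {ω : ℕ → E | ∀ k ≤ n, f (ω k) = a k} :=
    fun n ω ω' h hω k hk => (congrArg f (h k hk)).symm.trans (hω k hk)
  rw [Measure.map_apply hm (hdX n).measurableSet]
  change R.P z {ω | ∀ k ≤ n, f (ω k) = a k} = _
  induction n with
  | zero =>
    have hR : {ω : ℕ → E | ∀ k ≤ 0, f (ω k) = a k} =ᵐ[R.P z] {_ω : ℕ → E | f z = a 0} := by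
      filter_upwards [R.ae_init z] with ω hω
      change (∀ k ≤ 0, f (ω k) = a k) = (f z = a 0)
      simp [hω]
    have hX : {ω : ℕ → E' | ∀ k ≤ 0, ω k = a k} =ᵐ[X.P (f z)] {_ω : ℕ → E' | f z = a 0} := by
      filter_upwards [X.ae_init (f z)] with ω hω
      change (∀ k ≤ 0, ω k = a k) = (f z = a 0)
      simp [hω]
    rw [measure_congr hR, measure_congr hX]
    by_cases h : f z = a 0
    · rw [eq_true h, Set.ofPred_true, Set.ofPred_true, measure_univ, measure_univ]
    · simp [h]
  | succ n ih =>
    have hX : {ω : ℕ → E' | ∀ k ≤ n + 1, ω k = a k}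
        = {ω | ∀ k ≤ n, ω k = a k} ∩ {ω | ω (n + 1) ∈ ({a (n + 1)} : Set E')} := by
      ext ω
      simp [Nat.le_succ_iff, or_imp, forall_and]
    have hR : {ω : ℕ → E | ∀ k ≤ n + 1, f (ω k) = a k}
        = {ω | ∀ k ≤ n, f (ω k) = a k} ∩ {ω | ω (n + 1) ∈ f ⁻¹' {a (n + 1)}} := by
      ext ω
      simp [Nat.le_succ_iff, or_imp, forall_and]
    rw [hX, hR, X.measure_step_eq (f z) n (fun _ => {a (n + 1)})
      (X.P (a n) {ω | ω 1 = a (n + 1)}) (hdX n) fun ω hω => by rw [hω n le_rfl]; rfl,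
      R.measure_step_eq z n (fun _ => f ⁻¹' {a (n + 1)})
      (X.P (a n) {ω | ω 1 = a (n + 1)}) (hdR n) fun ω hω => by
        rw [← hω n le_rfl, ← hf]; rfl, ih]

end PathMeasure

section Coupling

/-- Any two probability vectors on a finite set are coupled by a stochastic matrix keeping as much
mass as possible in place. -/
theorem exists_coupling_matrix {S : Type*} [Fintype S] [DecidableEq S] (a b : S → ℝ)
    (ha : ∀ i, 0 ≤ a i) (hb : ∀ i, 0 ≤ b i) (ha1 : ∑ i, a i = 1) (hb1 : ∑ i, b i = 1) :
    ∃ κ : S → S → ℝ, (∀ i j, 0 ≤ κ i j) ∧ (∀ i, ∑ j, κ i j = 1) ∧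
      (∀ j, ∑ i, a i * κ i j = b j) ∧ ∀ i, min (a i) (b i) ≤ a i * κ i i := by
  set m := ∑ i, (b i - min (a i) (b i)) with hm
  have hm' : ∑ i, (a i - min (a i) (b i)) = m := by
    rw [hm, Finset.sum_sub_distrib, Finset.sum_sub_distrib, ha1, hb1]
  have hbm : ∀ i, 0 ≤ b i - min (a i) (b i) := fun i => sub_nonneg.2 (min_le_right _ _)
  have hm0 : 0 ≤ m := Finset.sum_nonneg fun i _ => hbm i
  let κ : S → S → ℝ := fun i j => if a i ≤ b i then (if i = j then 1 else 0) else
    b i / a i * (if i = j then 1 else 0) + (1 - b i / a i) * ((b j - min (a j) (b j)) / m)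
  have hprod : ∀ i j, a i * κ i j = min (a i) (b i) * (if i = j then 1 else 0)
      + (a i - min (a i) (b i)) * ((b j - min (a j) (b j)) / m) := by
    intro i j
    by_cases h : a i ≤ b i
    · simp [κ, h]
    · have hai : a i ≠ 0 := (lt_of_le_of_lt (hb i) (not_le.1 h)).ne'
      simp only [κ, if_neg h, min_eq_right (not_le.1 h).le]
      generalize (b j - min (a j) (b j)) / m = r
      generalize (if i = j then (1 : ℝ) else 0) = s
      field_simp
  refine ⟨κ, fun i j => ?_, fun i => ?_, fun j => ?_, fun i => ?_⟩
  · by_cases h : a i ≤ b i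
    · simp only [κ, if_pos h]
      split_ifs <;> norm_num
    · have h1 : b i / a i ≤ 1 := div_le_one_of_le₀ (not_le.1 h).le (ha i)
      simp only [κ, if_neg h]
      have h2 : (0 : ℝ) ≤ if i = j then 1 else 0 := by split_ifs <;> norm_num
      have := div_nonneg (hb i) (ha i)
      have := div_nonneg (hbm j) hm0
      have := sub_nonneg.2 h1
      positivity
  · by_cases h : a i ≤ b i
    · simp [κ, h]
    · have hmpos : m ≠ 0 := by
        rw [← hm']
        refine (Finset.sum_pos' (fun i _ => sub_nonneg.2 (min_le_left _ _))
          ⟨i, Finset.mem_univ i, ?_⟩).ne'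
        rw [min_eq_right (not_le.1 h).le]
        exact sub_pos.2 (not_le.1 h)
      simp only [κ, if_neg h, Finset.sum_add_distrib, ← Finset.mul_sum, ← Finset.sum_div]
      rw [← hm, div_self hmpos]
      simp
  · simp_rw [hprod, Finset.sum_add_distrib, ← Finset.sum_mul, hm']
    by_cases hmz : m = 0
    · have := (Finset.sum_eq_zero_iff_of_nonneg fun i _ => hbm i).1 hmz j (Finset.mem_univ j)
      simp only [hmz, zero_mul, add_zero, mul_ite, mul_one, mul_zero, Finset.sum_ite_eq',
        Finset.mem_univ, if_true]
      linarith
    · rw [mul_div_cancel₀ _ hmz]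
      simp
  · rw [hprod, if_pos rfl, mul_one]
    exact le_add_of_nonneg_right (mul_nonneg (sub_nonneg.2 (min_le_left _ _))
      (div_nonneg (hbm i) hm0))

theorem PMF.sum_toReal_eq_one {S : Type*} [Fintype S] (a : PMF S) : ∑ i, (a i).toReal = 1 := by
  rw [← ENNReal.toReal_sum fun i _ => a.apply_ne_top i, ← tsum_fintype (L := .unconditional S),
    a.tsum_coe, ENNReal.toReal_one]

/-- A PMF version of `exists_coupling_matrix`, with a bound on the decoupling probability. -/
theorem PMF.exists_coupling_kernel {S : Type*} [Fintype S] [DecidableEq S] (a b : PMF S) :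
    ∃ κ : S → PMF S, a.bind κ = b ∧
      (a.bind fun i => (κ i).map fun j => (i, j)).toOuterMeasure {q | q.1 ≠ q.2}
        ≤ ENNReal.ofReal (∑ j, |(a j).toReal - (b j).toReal|) := by
  obtain ⟨κ, h0, h1, hab, hmin⟩ := exists_coupling_matrix (fun i => (a i).toReal)
    (fun i => (b i).toReal) (fun _ => ENNReal.toReal_nonneg) (fun _ => ENNReal.toReal_nonneg)
    a.sum_toReal_eq_one b.sum_toReal_eq_one
  let κ' : S → PMF S := fun i => PMF.ofFintype (fun j => ENNReal.ofReal (κ i j)) (by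
    rw [← ENNReal.ofReal_sum_of_nonneg fun j _ => h0 i j, h1, ENNReal.ofReal_one])
  have hmul : ∀ i j, a i * κ' i j = ENNReal.ofReal ((a i).toReal * κ i j) := fun i j => by
    rw [ENNReal.ofReal_mul ENNReal.toReal_nonneg, ENNReal.ofReal_toReal (a.apply_ne_top i)]
    rfl
  refine ⟨κ', ?_, ?_⟩
  · ext j
    rw [PMF.bind_apply, tsum_fintype]
    simp_rw [hmul]
    rw [← ENNReal.ofReal_sum_of_nonneg fun i _ => mul_nonneg ENNReal.toReal_nonneg (h0 i j), hab,
      ENNReal.ofReal_toReal (b.apply_ne_top j)]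
  · rw [PMF.toOuterMeasure_bind_apply, tsum_fintype,
      ENNReal.ofReal_sum_of_nonneg fun j _ => abs_nonneg _]
    refine Finset.sum_le_sum fun i _ => ?_
    rw [PMF.toOuterMeasure_map_apply, PMF.toOuterMeasure_apply_fintype, Finset.mul_sum]
    have hterm : ∀ j, a i * Set.indicator ((fun j => (i, j)) ⁻¹' {q : S × S | q.1 ≠ q.2}) (κ' i) j
        = ENNReal.ofReal ((a i).toReal * (κ i j - if i = j then κ i j else 0)) := by
      intro j
      by_cases h : i = j <;> simp [Set.indicator, h, hmul]
    simp_rw [hterm]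
    rw [← ENNReal.ofReal_sum_of_nonneg, ← Finset.mul_sum, Finset.sum_sub_distrib, h1]
    · refine ENNReal.ofReal_le_ofReal ?_
      have := hmin i
      have h2 : (a i).toReal - (b i).toReal ≤ |(a i).toReal - (b i).toReal| := le_abs_self _
      have h3 := abs_nonneg ((a i).toReal - (b i).toReal)
      simp only [Finset.sum_ite_eq, Finset.mem_univ, if_true, mul_sub, mul_one]
      rcases min_cases (a i).toReal (b i).toReal with h | h <;> linarith
    · intro j _
      refine mul_nonneg ENNReal.toReal_nonneg ?_
      split_ifs
      · simp
      · simpa using h0 i j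

/-- A PMF `μ` can be coupled with a PMF `b` on a finite set so that the second coordinate agrees
with the image of the first under `f`, up to the `ℓ¹`-distance of the laws. -/
theorem PMF.exists_coupling {α S : Type*} [Fintype S] [DecidableEq S] (μ : PMF α) (f : α → S)
    (b : PMF S) :
    ∃ ν : PMF (α × S), ν.map Prod.fst = μ ∧ ν.map Prod.snd = b ∧
      ν.toOuterMeasure {q | f q.1 ≠ q.2}
        ≤ ENNReal.ofReal (∑ j, |(μ.map f j).toReal - (b j).toReal|) := by
  obtain ⟨κ, hκ, hle⟩ := PMF.exists_coupling_kernel (μ.map f) b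
  refine ⟨μ.bind fun y => (κ (f y)).map fun j => (y, j), ?_, ?_, ?_⟩
  · have hconst : ∀ y, (κ (f y)).map (fun _ => y) = PMF.pure y := fun y => PMF.map_const _ _
    simp [PMF.map_bind, PMF.map_comp, Function.comp_def, hconst]
  · have hid : ∀ p : PMF S, p.map (fun j => j) = p := PMF.map_id
    simp only [PMF.map_bind, PMF.map_comp, Function.comp_def, hid]
    rw [← hκ, PMF.bind_map]
    rfl
  · refine le_trans (le_of_eq ?_) hle
    rw [PMF.bind_map, PMF.toOuterMeasure_bind_apply, PMF.toOuterMeasure_bind_apply]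
    simp only [PMF.toOuterMeasure_map_apply, Function.comp_def]
    rfl

end Coupling

section CoupledChain

omit [Nonempty S] in
/-- A half-strip chain can be coupled with a chain on `S` having transition matrix `Q` so that at
each step the `S`-components decouple with probability at most the `ℓ¹`-distance of the respective
transition probabilities. -/
theorem exists_coupled_chain (X : MChain (ℕ × S)) (Q : S → S → ℝ) (hQ : IsStochasticMatrix Q) :
    ∃ (R : MChain (ℕ × S × S)) (W : MChain S),
      (∀ (x : ℕ) (i i' : S),
        Measure.map (fun (ω : ℕ → ℕ × S × S) (n : ℕ) => ((ω n).1, (ω n).2.1))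
          (R.P (x, i, i')) = X.P (x, i)) ∧
      (∀ i j : S, W.P i {ω | ω 1 = j} = ENNReal.ofReal (Q i j)) ∧
      (∀ (x : ℕ) (i i' : S),
        Measure.map (fun (ω : ℕ → ℕ × S × S) (n : ℕ) => (ω n).2.2)
          (R.P (x, i, i')) = W.P i') ∧
      ∀ (x : ℕ) (i i' : S), R.P (x, i, i') {ω | (ω 1).2.1 ≠ (ω 1).2.2}
        ≤ ENNReal.ofReal (∑ j, |qhat X x i j - Q i' j|) := by
  have hmeas : Measurable fun ω : ℕ → ℕ × S => ω 1 := measurable_pi_apply 1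
  have hprob : ∀ z, IsProbabilityMeasure ((X.P z).map fun ω => ω 1) := fun z =>
    have := X.isProb z
    Measure.isProbabilityMeasure_map hmeas.aemeasurable
  let law : ℕ × S → PMF (ℕ × S) := fun z => ((X.P z).map fun ω => ω 1).toPMF
  let q : S → PMF S := fun i => PMF.ofFintype (fun j => ENNReal.ofReal (Q i j)) (by
    rw [← ENNReal.ofReal_sum_of_nonneg fun j _ => hQ.1 i j, hQ.2, ENNReal.ofReal_one])
  have hlaw : ∀ z (U : Set (ℕ × S)), (law z).toMeasure U = X.P z {ω | ω 1 ∈ U} := fun z U => by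
    rw [Measure.toPMF_toMeasure, Measure.map_apply hmeas (Set.to_countable U).measurableSet]
    rfl
  have hqhat : ∀ z j, ((law z).map Prod.snd j).toReal = qhat X z.1 z.2 j := fun z j => by
    rw [← PMF.toMeasure_apply_singleton _ _ (measurableSet_singleton j),
      PMF.toMeasure_map_apply _ _ _ measurable_snd (measurableSet_singleton j), hlaw]
    rfl
  have hqr : ∀ i j, (q i j).toReal = Q i j := fun i j => ENNReal.toReal_ofReal (hQ.1 i j)
  choose ν hν₁ hν₂ hν₃ using fun z : ℕ × S × S =>
    PMF.exists_coupling (law (z.1, z.2.1)) Prod.snd (q z.2.2)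
  let g : (ℕ × S) × S → ℕ × S × S := fun u => (u.1.1, u.1.2, u.2)
  let R : MChain (ℕ × S × S) := MChain.ofKernel fun z => ((ν z).map g).toMeasure
  let W : MChain S := MChain.ofKernel fun i => (q i).toMeasure
  have hW : ∀ i j : S, W.P i {ω | ω 1 = j} = q i j := fun i j => by
    have := MChain.ofKernel_apply_one (fun i => (q i).toMeasure) i {j}
    rwa [PMF.toMeasure_apply_singleton _ _ (measurableSet_singleton j)] at this
  have hR : ∀ z U, R.P z {ω | ω 1 ∈ U} = ((ν z).map g).toOuterMeasure U := fun z U => by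
    rw [← PMF.toMeasure_apply_eq_toOuterMeasure]
    exact MChain.ofKernel_apply_one (fun z => ((ν z).map g).toMeasure) z U
  refine ⟨R, W, fun x i i' => ?_, hW, fun x i i' => ?_, fun x i i' => ?_⟩
  · refine R.map_eq_of_step X (fun z => (z.1, z.2.1)) (fun z b => ?_) (x, i, i')
    have h1 := hR z ((fun z => (z.1, z.2.1)) ⁻¹' {b})
    have h2 := hlaw (z.1, z.2.1) {b}
    rw [PMF.toMeasure_apply_eq_toOuterMeasure, ← hν₁ z, PMF.toOuterMeasure_map_apply] at h2
    rw [PMF.toOuterMeasure_map_apply] at h1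
    exact h1.trans h2
  · refine R.map_eq_of_step W (fun z => z.2.2) (fun z b => ?_) (x, i, i')
    have h1 := hR z ((fun z => z.2.2) ⁻¹' {b})
    rw [PMF.toOuterMeasure_map_apply] at h1
    rw [hW, ← hν₂ z, ← PMF.toOuterMeasure_apply_singleton, PMF.toOuterMeasure_map_apply]
    exact h1
  · have h1 := hR (x, i, i') {z | z.2.1 ≠ z.2.2}
    rw [PMF.toOuterMeasure_map_apply] at h1
    refine h1.trans_le ((hν₃ (x, i, i')).trans_eq ?_)
    simp_rw [hqhat, hqr]

omit [DecidableEq S] [Nonempty S] in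
/-- Markov's inequality for the jumps of the `ℕ`-coordinate under (B_p). -/
theorem measure_jump_le (X : MChain (ℕ × S)) {p : ℝ} (hp : 0 < p) {C : ℝ≥0∞} (x : ℕ) (i : S)
    (hC : (∫⁻ ω, ENNReal.ofReal (|((ω 1).1 : ℝ) - (x : ℝ)| ^ p) ∂(X.P (x, i))) ≤ C)
    {h : ℝ} (hh : 0 < h) :
    X.P (x, i) {ω | ((ω 1).1 : ℝ) < x - h} ≤ C / ENNReal.ofReal (h ^ p) := by
  have hm : Measurable fun ω : ℕ → ℕ × S =>
      ENNReal.ofReal (|((ω 1).1 : ℝ) - (x : ℝ)| ^ p) :=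
    (Measurable.of_discrete (f := fun z : ℕ × S =>
      ENNReal.ofReal (|(z.1 : ℝ) - (x : ℝ)| ^ p))).comp (measurable_pi_apply 1)
  have hpos : 0 < h ^ p := Real.rpow_pos_of_pos hh p
  refine le_trans (measure_mono fun ω hω => ?_) ((meas_ge_le_lintegral_div hm.aemeasurable
    (ENNReal.ofReal_pos.2 hpos).ne' ENNReal.ofReal_ne_top).trans (by gcongr))
  refine ENNReal.ofReal_le_ofReal (Real.rpow_le_rpow hh.le ?_ hp.le)
  have : ((ω 1).1 : ℝ) < x - h := hω
  rw [abs_sub_comm]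
  exact le_trans (by linarith) (le_abs_self _)

omit [Fintype S] [DecidableEq S] [Nonempty S] in
/-- If, from agreeing states at height at least `x - n h`, the components of the next state
disagree or the height drops by more than `h` with probability at most `c`, then the components
disagree by time `n` with probability at most `n c`. -/
theorem measure_decoupled_le [Countable S] (R : MChain (ℕ × S × S)) (x : ℕ) (i : S) (n : ℕ)
    {h : ℝ} (hh : 0 ≤ h) (c : ℝ≥0∞)
    (hc : ∀ (y : ℕ) (j : S), (x : ℝ) - n * h ≤ y →
      R.P (y, j, j) {ω | (ω 1).2.1 ≠ (ω 1).2.2 ∨ ((ω 1).1 : ℝ) < y - h} ≤ c) :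
    R.P (x, i, i) {ω | ∀ k ≤ n, (ω k).2.1 = (ω k).2.2}ᶜ ≤ n * c := by
  let G : ℕ → Set (ℕ → ℕ × S × S) := fun m =>
    {ω | ∀ k ≤ m, (ω k).2.1 = (ω k).2.2 ∧ (x : ℝ) - k * h ≤ (ω k).1}
  have hG : ∀ m, DeterminedUpTo m (G m) := fun m ω ω' hω hmem k hk => by
    rw [← hω k hk]
    exact hmem k hk
  let U : ℕ × S × S → Set (ℕ × S × S) := fun z =>
    {z' | z'.2.1 ≠ z'.2.2 ∨ (z'.1 : ℝ) < z.1 - h}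
  have key : ∀ m ≤ n, R.P (x, i, i) (G m)ᶜ ≤ m * c := by
    intro m
    induction m with
    | zero =>
      intro _
      have : R.P (x, i, i) (G 0)ᶜ = 0 := by
        change ∀ᵐ ω ∂(R.P (x, i, i)), ω ∈ G 0
        filter_upwards [R.ae_init (x, i, i)] with ω hω k hk
        obtain rfl := Nat.le_zero.1 hk
        simp [hω]
      simp [this]
    | succ m ih =>
      intro hm
      have hsub : (G (m + 1))ᶜ ⊆ (G m)ᶜ ∪ (G m ∩ {ω | ω (m + 1) ∈ U (ω m)}) := by
        intro ω hω
        by_cases hωm : ω ∈ G m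
        · refine Or.inr ⟨hωm, ?_⟩
          by_contra hU
          refine hω fun k hk => ?_
          rcases Nat.le_succ_iff.1 hk with hk | rfl
          · exact hωm k hk
          · have hU' : ¬((ω (m + 1)).2.1 ≠ (ω (m + 1)).2.2 ∨
              ((ω (m + 1)).1 : ℝ) < (ω m).1 - h) := hU
            push Not at hU'
            refine ⟨hU'.1, ?_⟩
            have := (hωm m le_rfl).2
            push_cast
            linarith [hU'.2]
        · exact Or.inl hωm
      have hstep : R.P (x, i, i) (G m ∩ {ω | ω (m + 1) ∈ U (ω m)}) ≤ c := by
        refine R.measure_step_le (x, i, i) m U c (hG m) fun ω hω => ?_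
        obtain ⟨h1, h2⟩ := hω m le_rfl
        have hz : ω m = ((ω m).1, (ω m).2.1, (ω m).2.1) :=
          Prod.ext rfl (Prod.ext rfl h1.symm)
        have hheight : (x : ℝ) - n * h ≤ ((ω m).1 : ℝ) := by
          have : (m : ℝ) * h ≤ n * h := by
            gcongr
            exact (Nat.lt_of_succ_le hm).le
          linarith
        have := hc (ω m).1 (ω m).2.1 hheight
        rw [← hz] at this
        exact this
      calc R.P (x, i, i) (G (m + 1))ᶜ
          ≤ R.P (x, i, i) (G m)ᶜ + R.P (x, i, i) (G m ∩ {ω | ω (m + 1) ∈ U (ω m)}) :=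
            (measure_mono hsub).trans (measure_union_le _ _)
        _ ≤ m * c + c := add_le_add (ih (Nat.le_of_succ_le hm)) hstep
        _ = (m + 1 : ℕ) * c := by push_cast; ring
  refine (measure_mono (Set.compl_subset_compl.2 fun ω hω k hk => ?_)).trans (key n le_rfl)
  exact (hω k hk).1

omit [DecidableEq S] [Nonempty S] in
/-- Quantitative survival bound for a coupling of the `S`-components. -/
theorem one_sub_measure_coupled_le (X : MChain (ℕ × S)) (Q : S → S → ℝ) (R : MChain (ℕ × S × S))
    (hmap : ∀ (x : ℕ) (i i' : S),
      Measure.map (fun (ω : ℕ → ℕ × S × S) (n : ℕ) => ((ω n).1, (ω n).2.1))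
        (R.P (x, i, i')) = X.P (x, i))
    (hdec : ∀ (x : ℕ) (i i' : S), R.P (x, i, i') {ω | (ω 1).2.1 ≠ (ω 1).2.2}
      ≤ ENNReal.ofReal (∑ j, |qhat X x i j - Q i' j|))
    {p : ℝ} (hp : 0 < p) {C : ℝ≥0∞} (hCtop : C ≠ ⊤)
    (hC : ∀ (x : ℕ) (i : S),
      (∫⁻ ω, ENNReal.ofReal (|((ω 1).1 : ℝ) - (x : ℝ)| ^ p) ∂(X.P (x, i))) ≤ C)
    (x : ℕ) (i : S) (n : ℕ) {h b : ℝ} (hh : 0 < h) (hb0 : 0 ≤ b)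
    (hb : ∀ (y : ℕ) (j : S), (x : ℝ) - n * h ≤ y → ∑ j', |qhat X y j j' - Q j j'| ≤ b) :
    1 - (R.P (x, i, i) {ω | ∀ k ≤ n, (ω k).2.1 = (ω k).2.2}).toReal
      ≤ n * (b + C.toReal / h ^ p) := by
  have := R.isProb (x, i, i)
  have hpos : 0 < h ^ p := Real.rpow_pos_of_pos hh p
  have hdet : DeterminedUpTo n {ω : ℕ → ℕ × S × S | ∀ k ≤ n, (ω k).2.1 = (ω k).2.2} :=
    fun ω ω' hω hmem k hk => by
      rw [← hω k hk]
      exact hmem k hk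
  have hproj : Measurable fun (ω : ℕ → ℕ × S × S) (n : ℕ) => ((ω n).1, (ω n).2.1) := by
    fun_prop
  have hle := measure_decoupled_le R x i n hh.le (ENNReal.ofReal (b + C.toReal / h ^ p))
    fun y j hy => by
      refine (measure_mono (fun ω hω => hω :
        _ ⊆ {ω : ℕ → ℕ × S × S | (ω 1).2.1 ≠ (ω 1).2.2} ∪
          {ω : ℕ → ℕ × S × S | ((ω 1).1 : ℝ) < y - h})).trans
        ((measure_union_le _ _).trans ?_)
      rw [ENNReal.ofReal_add hb0 (by positivity), ENNReal.ofReal_div_of_pos hpos,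
        ENNReal.ofReal_toReal hCtop]
      refine add_le_add ((hdec y j j).trans (ENNReal.ofReal_le_ofReal (hb y j hy))) ?_
      refine le_trans (le_of_eq ?_) (measure_jump_le X hp y j (hC y j) hh)
      rw [← hmap y j j, Measure.map_apply hproj]
      · rfl
      · exact measurableSet_coord_mem 1 {z : ℕ × S | (z.1 : ℝ) < y - h}
  have hreal := ENNReal.toReal_mono (by finiteness) hle
  rw [prob_compl_eq_one_sub hdet.measurableSet,
    ENNReal.toReal_sub_of_le prob_le_one ENNReal.one_ne_top, ENNReal.toReal_one,
    ENNReal.toReal_mul, ENNReal.toReal_natCast, ENNReal.toReal_ofReal (by positivity)] at hreal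
  exact hreal

end CoupledChain

section Asymptotics

omit [DecidableEq S] [Nonempty S] [MeasurableSingletonClass S] in
theorem tendsto_measure_coupled (X : MChain (ℕ × S)) (Q : S → S → ℝ)
    (hQ : ∀ i j, Tendsto (fun x : ℕ => qhat X x i j) atTop (nhds (Q i j)))
    (R : MChain (ℕ × S × S)) {p C : ℝ} (hp : 0 < p)
    (hbound : ∀ (x : ℕ) (i : S) (n : ℕ) (h b : ℝ), 0 < h → 0 ≤ b →
      (∀ (y : ℕ) (j : S), (x : ℝ) - n * h ≤ y → ∑ j', |qhat X y j j' - Q j j'| ≤ b) →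
      1 - (R.P (x, i, i) {ω | ∀ k ≤ n, (ω k).2.1 = (ω k).2.2}).toReal ≤ n * (b + C / h ^ p))
    (n : ℕ) (i : S) :
    Tendsto (fun x : ℕ => (R.P (x, i, i) {ω | ∀ k ≤ n, (ω k).2.1 = (ω k).2.2}).toReal)
      atTop (nhds 1) := by
  rw [tendsto_order]
  have hle : ∀ x : ℕ, (R.P (x, i, i) {ω | ∀ k ≤ n, (ω k).2.1 = (ω k).2.2}).toReal ≤ 1 := fun x =>
    have := R.isProb (x, i, i)
    ENNReal.toReal_le_of_le_ofReal zero_le_one (by simpa using prob_le_one)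
  refine ⟨fun a ha => ?_, fun a ha => Eventually.of_forall fun x => (hle x).trans_lt ha⟩
  have hb : 0 < (1 - a) / (n + 1) / 2 := by
    have := sub_pos.2 ha
    positivity
  set b := (1 - a) / (n + 1) / 2 with hbdef
  have hlim : Tendsto (fun h : ℝ => C / h ^ p) atTop (nhds 0) :=
    tendsto_const_nhds.div_atTop (tendsto_rpow_atTop hp)
  obtain ⟨h, hhb, hh⟩ := ((hlim.eventually_lt_const hb).and (eventually_gt_atTop 0)).exists
  have hε : ∀ᶠ y : ℕ in atTop, ∀ j, ∑ j', |qhat X y j j' - Q j j'| < b := by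
    refine eventually_all.2 fun j => ?_
    have : Tendsto (fun y : ℕ => ∑ j', |qhat X y j j' - Q j j'|) atTop (nhds 0) := by
      have := tendsto_finsetSum (Finset.univ : Finset S) fun j' _ =>
        ((hQ j j').sub_const (Q j j')).abs
      simpa using this
    exact this.eventually_lt_const hb
  obtain ⟨N, hN⟩ := eventually_atTop.1 hε
  filter_upwards [tendsto_natCast_atTop_atTop.eventually_ge_atTop ((N : ℝ) + n * h)] with x hx
  have hx' := hbound x i n h b hh hb.le fun y j hy =>
    (hN y (by exact_mod_cast (by linarith : (N : ℝ) ≤ y)) j).le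
  have hlt : (n : ℝ) * (b + C / h ^ p) < 1 - a := by
    calc (n : ℝ) * (b + C / h ^ p) ≤ n * (b + b) := by gcongr
      _ < (n + 1) * (b + b) := by gcongr; linarith
      _ = 1 - a := by
        rw [hbdef]
        field_simp
        ring
  linarith

omit [DecidableEq S] [Nonempty S] [MeasurableSingletonClass S] in
theorem isBigO_measure_coupled (X : MChain (ℕ × S)) (Q : S → S → ℝ) {δ₀ : ℝ} (hδ₀ : 0 < δ₀)
    (hO : ∀ i j, (fun x : ℕ => qhat X x i j - Q i j) =O[atTop] fun x : ℕ => (x : ℝ) ^ (-δ₀))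
    (R : MChain (ℕ × S × S)) {p C : ℝ} (hp : 0 < p)
    (hbound : ∀ (x : ℕ) (i : S) (n : ℕ) (h b : ℝ), 0 < h → 0 ≤ b →
      (∀ (y : ℕ) (j : S), (x : ℝ) - n * h ≤ y → ∑ j', |qhat X y j j' - Q j j'| ≤ b) →
      1 - (R.P (x, i, i) {ω | ∀ k ≤ n, (ω k).2.1 = (ω k).2.2}).toReal ≤ n * (b + C / h ^ p)) :
    ∃ δ : ℝ, 0 < δ ∧ ∀ (A : ℝ) (i : S),
      (fun x : ℕ => 1 - (R.P (x, i, i) {ω | ∀ k : ℕ, (k : ℝ) ≤ A * Real.log x →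
        (ω k).2.1 = (ω k).2.2}).toReal) =O[atTop] fun x : ℕ => (x : ℝ) ^ (-δ) := by
  have hsum : (fun y : ℕ => ∑ j, ∑ j', |qhat X y j j' - Q j j'|)
      =O[atTop] fun x : ℕ => (x : ℝ) ^ (-δ₀) :=
    IsBigO.fun_sum fun j _ => IsBigO.fun_sum fun j' _ => (hO j j').abs_left
  obtain ⟨M, hM, hMb⟩ := hsum.exists_pos
  obtain ⟨N, hN⟩ := eventually_atTop.1 hMb.bound
  set δ := min δ₀ (p / 2) / 2 with hδdef
  have hδ : 0 < δ := by positivity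
  have hδ1 : 2 * δ ≤ δ₀ := by rw [hδdef]; linarith [min_le_left δ₀ (p / 2)]
  have hδ2 : 2 * δ ≤ p / 2 := by rw [hδdef]; linarith [min_le_right δ₀ (p / 2)]
  refine ⟨δ, hδ, fun A i => ?_⟩
  have hlog : (fun x : ℕ => |A| * Real.log x) =O[atTop] fun x : ℕ => (x : ℝ) ^ δ :=
    ((isLittleO_log_rpow_atTop hδ).comp_tendsto tendsto_natCast_atTop_atTop).isBigO.const_mul_left _
  have hlog' : ∀ᶠ x : ℕ in atTop, |A| * Real.log x ≤ 1 / 2 * (x : ℝ) ^ (1 / 2 : ℝ) := by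
    have := ((isLittleO_log_rpow_atTop (r := 1 / 2) (by norm_num)).comp_tendsto
      tendsto_natCast_atTop_atTop).const_mul_left |A|
    filter_upwards [this.bound (c := 1 / 2) (by norm_num)] with x hx
    refine (le_abs_self _).trans (hx.trans_eq ?_)
    rw [Function.comp_apply, Real.norm_of_nonneg (by positivity)]
  have hpow : ∀ r : ℝ, 2 * δ ≤ r → (fun x : ℕ => (x : ℝ) ^ (-r)) =O[atTop]
      fun x : ℕ => (x : ℝ) ^ (-(2 * δ)) := fun r hr => by
    refine IsBigO.of_bound 1 ?_
    filter_upwards [eventually_ge_atTop 1] with x hx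
    rw [Real.norm_of_nonneg (by positivity), Real.norm_of_nonneg (by positivity), one_mul]
    exact Real.rpow_le_rpow_of_exponent_le (by exact_mod_cast hx) (by linarith)
  have hrate : (fun x : ℕ => |A| * Real.log x *
      (M * 2 ^ δ₀ * (x : ℝ) ^ (-δ₀) + |C| * (x : ℝ) ^ (-(p / 2))))
      =O[atTop] fun x : ℕ => (x : ℝ) ^ (-δ) := by
    refine (hlog.mul (((hpow δ₀ hδ1).const_mul_left _).add
      ((hpow (p / 2) hδ2).const_mul_left _))).congr' EventuallyEq.rfl ?_
    filter_upwards [eventually_gt_atTop 0] with x hx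
    rw [← Real.rpow_add (by exact_mod_cast hx)]
    ring_nf
  refine IsBigO.trans (IsBigO.of_bound 1 ?_) hrate
  filter_upwards [hlog', eventually_ge_atTop 1, eventually_ge_atTop (2 * N)] with x hx hx1 hxN
  have := R.isProb (x, i, i)
  have hx1' : (1 : ℝ) ≤ x := by exact_mod_cast hx1
  have hx0 : (0 : ℝ) < x := by linarith
  have hxN' : 2 * (N : ℝ) ≤ x := by exact_mod_cast hxN
  have hl0 : 0 ≤ Real.log x := Real.log_nonneg hx1'
  set n := ⌊A * Real.log x⌋₊ with hn
  have hnle : (n : ℝ) ≤ |A| * Real.log x := by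
    have h0 : 0 ≤ |A| * Real.log x := by positivity
    refine le_trans ?_ (Nat.floor_le h0)
    exact_mod_cast Nat.floor_le_floor (by gcongr; exact le_abs_self A)
  have hsqrt : (x : ℝ) ^ (1 / 2 : ℝ) * (x : ℝ) ^ (1 / 2 : ℝ) = x := by
    rw [← Real.rpow_add hx0]
    norm_num
  have hhalf : (n : ℝ) * (x : ℝ) ^ (1 / 2 : ℝ) ≤ x / 2 := by
    calc (n : ℝ) * (x : ℝ) ^ (1 / 2 : ℝ)
        ≤ 1 / 2 * (x : ℝ) ^ (1 / 2 : ℝ) * (x : ℝ) ^ (1 / 2 : ℝ) := by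
          gcongr
          exact hnle.trans hx
      _ = x / 2 := by rw [mul_assoc, hsqrt]; ring
  have hmain := hbound x i n ((x : ℝ) ^ (1 / 2 : ℝ)) (M * 2 ^ δ₀ * (x : ℝ) ^ (-δ₀))
    (by positivity) (by positivity) fun y j hy => by
      have hxy : (x : ℝ) / 2 ≤ y := by linarith
      have hyN : N ≤ y := by exact_mod_cast (by linarith : (N : ℝ) ≤ y)
      calc ∑ j', |qhat X y j j' - Q j j'|
          ≤ ∑ j, ∑ j', |qhat X y j j' - Q j j'| :=
            Finset.single_le_sum (f := fun j => ∑ j', |qhat X y j j' - Q j j'|)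
              (fun j _ => Finset.sum_nonneg fun _ _ => abs_nonneg _) (Finset.mem_univ j)
        _ ≤ M * (y : ℝ) ^ (-δ₀) := by
            refine (le_abs_self _).trans ((hN y hyN).trans_eq ?_)
            rw [Real.norm_of_nonneg (by positivity)]
        _ ≤ M * ((x : ℝ) / 2) ^ (-δ₀) := by
            gcongr M * ?_
            exact Real.rpow_le_rpow_of_nonpos (by positivity) hxy (by linarith)
        _ = M * 2 ^ δ₀ * (x : ℝ) ^ (-δ₀) := by
            rw [Real.div_rpow hx0.le zero_le_two, Real.rpow_neg zero_le_two, div_inv_eq_mul]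
            ring
  rw [← Real.rpow_mul hx0.le, div_eq_mul_inv C, ← Real.rpow_neg hx0.le,
    show -(1 / 2 * p) = -(p / 2) by ring] at hmain
  have hmono : (R.P (x, i, i) {ω | ∀ k ≤ n, (ω k).2.1 = (ω k).2.2}).toReal
      ≤ (R.P (x, i, i) {ω | ∀ k : ℕ, (k : ℝ) ≤ A * Real.log x →
        (ω k).2.1 = (ω k).2.2}).toReal := by
    refine ENNReal.toReal_mono (by finiteness) (measure_mono fun ω hω k hk => ?_)
    exact hω k (Nat.le_floor hk)
  have hle1 : (R.P (x, i, i) {ω | ∀ k : ℕ, (k : ℝ) ≤ A * Real.log x →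
      (ω k).2.1 = (ω k).2.2}).toReal ≤ 1 :=
    ENNReal.toReal_le_of_le_ofReal zero_le_one (by simpa using prob_le_one)
  rw [Real.norm_of_nonneg (sub_nonneg.2 hle1), one_mul, Real.norm_of_nonneg (by positivity)]
  calc _ ≤ (n : ℝ) * (M * 2 ^ δ₀ * (x : ℝ) ^ (-δ₀) + C * (x : ℝ) ^ (-(p / 2))) := by linarith
    _ ≤ n * (M * 2 ^ δ₀ * (x : ℝ) ^ (-δ₀) + |C| * (x : ℝ) ^ (-(p / 2))) := by
        gcongr
        exact le_abs_self C
    _ ≤ _ := by gcongr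

end Asymptotics

/-- Lemma (coupling): under (B_p) for some `p > 1` and (Q_∞), there exists a Markov chain
`(X_n, η_n, η*_n)` on `ℕ × S × S` whose `(X,η)`-marginal has the law of the original chain,
whose `η*`-marginal is a Markov chain with transition matrix `q`, and such that the two
`S`-components agree for the first `n` steps with probability tending to `1` as `x → ∞`;
under (Q_∞^+) the coupling survives for `A log x` steps with probability `1 − O(x^{-δ})`. -/
theorem stmt7 (X : MChain (ℕ × S)) (hirr : X.Irreducible)
    (p : ℝ) (hp : 1 < p) (hB : CondB X p)
    (Q : S → S → ℝ) (hQ : CondQ X Q) :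
    ∃ (R : MChain (ℕ × S × S)) (W : MChain S),
      (∀ (x : ℕ) (i i' : S),
        Measure.map (fun (ω : ℕ → ℕ × S × S) (n : ℕ) => ((ω n).1, (ω n).2.1))
          (R.P (x, i, i')) = X.P (x, i)) ∧
      (∀ i j : S, W.P i {ω | ω 1 = j} = ENNReal.ofReal (Q i j)) ∧
      (∀ (x : ℕ) (i i' : S),
        Measure.map (fun (ω : ℕ → ℕ × S × S) (n : ℕ) => (ω n).2.2)
          (R.P (x, i, i')) = W.P i') ∧
      (∀ (n : ℕ) (i : S),
        Tendsto (fun x : ℕ =>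
            (R.P (x, i, i) {ω | ∀ k ≤ n, (ω k).2.1 = (ω k).2.2}).toReal)
          atTop (nhds 1)) ∧
      (CondQplus X Q → ∃ δ : ℝ, 0 < δ ∧ ∀ (A : ℝ) (i : S),
        (fun x : ℕ => 1 -
            (R.P (x, i, i) {ω | ∀ k : ℕ, (k : ℝ) ≤ A * Real.log x →
              (ω k).2.1 = (ω k).2.2}).toReal)
          =O[atTop] fun x : ℕ => (x : ℝ) ^ (-δ)) := by
  obtain ⟨C, hCtop, hC⟩ := hB
  obtain ⟨R, W, h1, h2, h3, hdec⟩ := exists_coupled_chain X Q hQ.2.1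
  have hp0 : 0 < p := one_pos.trans hp
  have hbound := fun x i n (h b : ℝ) => one_sub_measure_coupled_le X Q R h1 hdec hp0 hCtop hC
    x i n (h := h) (b := b)
  refine ⟨R, W, h1, h2, h3, fun n i => ?_, fun hQ' => ?_⟩
  · exact tendsto_measure_coupled X Q hQ.1 R hp0 hbound n i
  · obtain ⟨δ₀, hδ₀, hO⟩ := hQ'.1
    exact isBigO_measure_coupled X Q hδ₀ hO R hp0 hbound
end

section
/- Suppose condition (B_p) holds for some p > 1 and condition (Q_∞) holds. Then, for any i ∈ S, lim_{x→∞} E_{x,0}[Σ_{k=0}^{τ−1} 1{η_k = i}] = π(i)/π(0). If, in addition, condition (Q_∞^+) holds, then there exists δ > 0 such that for any i ∈ S, |E_{x,0}[Σ_{k=0}^{τ−1} 1{η_k = i}] − π(i)/π(0)| = O(x^{−δ}) as x → ∞. -/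
open MeasureTheory Filter Topology Asymptotics
open scoped ENNReal NNReal

variable {S : Type*} [Fintype S] [DecidableEq S] [Nonempty S]
  [MeasurableSpace S] [MeasurableSingletonClass S]

namespace MChain

variable {E : Type*} [MeasurableSpace E]

instance (X : MChain E) (z : E) : IsProbabilityMeasure (X.P z) := X.isProb z

theorem ae_init_s10 (X : MChain E) [MeasurableSingletonClass E] (z : E) : ∀ᵐ ω ∂X.P z, ω 0 = z := by
  have hm : MeasurableSet {ω : ℕ → E | ω 0 = z} :=
    measurable_pi_apply (X := fun _ : ℕ => E) 0 (measurableSet_singleton z)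
  exact (mem_ae_iff_prob_eq_one hm).2 (X.init z)

variable [Countable E] [MeasurableSingletonClass E]

theorem measurable_comp_eval_pair {β : Type*} [MeasurableSpace β] (g : E × E → β) (m n : ℕ) :
    Measurable fun ω : ℕ → E => g (ω m, ω n) := by
  have hg : Measurable g := measurable_of_countable g
  have hmn : Measurable fun ω : ℕ → E => (ω m, ω n) :=
    (measurable_pi_apply m).prodMk (measurable_pi_apply n)
  exact hg.comp hmn

theorem setLIntegral_shift (X : MChain E) (z : E) (n : ℕ) {B : Set (ℕ → E)}
    (hB : MeasurableSet B)
    (hBn : ∀ ω ω' : ℕ → E, (∀ k, k ≤ n → ω k = ω' k) → ω ∈ B → ω' ∈ B)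
    {F : (ℕ → E) → ℝ≥0∞} (hF : Measurable F) :
    ∫⁻ ω in B, F (fun k => ω (n + k)) ∂X.P z
      = ∫⁻ ω in B, (∫⁻ ω', F ω' ∂X.P (ω n)) ∂X.P z := by
  have hshift : Measurable (fun ω : ℕ → E => fun k => ω (n + k)) :=
    measurable_pi_lambda _ fun k => measurable_pi_apply _
  have hm : ∀ w, MeasurableSet (B ∩ {ω : ℕ → E | ω n = w}) := fun w =>
    hB.inter (measurable_pi_apply (X := fun _ : ℕ => E) n (measurableSet_singleton w))
  have hd : Pairwise (Function.onFun Disjoint fun w => B ∩ {ω : ℕ → E | ω n = w}) := by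
    intro w w' hw
    rw [Function.onFun, Set.disjoint_left]
    rintro ω ⟨-, h⟩ ⟨-, h'⟩
    exact hw (h.symm.trans h')
  have hU : B = ⋃ w, B ∩ {ω : ℕ → E | ω n = w} := by
    ext ω; simp
  rw [hU, lintegral_iUnion hm hd, lintegral_iUnion hm hd]
  refine tsum_congr fun w => ?_
  have hmap : ((X.P z).restrict (B ∩ {ω : ℕ → E | ω n = w})).map
      (fun ω : ℕ → E => fun k => ω (n + k)) = X.P z (B ∩ {ω : ℕ → E | ω n = w}) • X.P w := by
    ext A hA
    rw [Measure.map_apply hshift hA, Measure.restrict_apply (hshift hA), Set.inter_comm]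
    rw [Measure.smul_apply, smul_eq_mul]
    exact X.markov z n w A B hA hBn
  rw [← lintegral_map hF hshift, hmap, lintegral_smul_measure]
  have : ∫⁻ ω in B ∩ {ω : ℕ → E | ω n = w}, (∫⁻ ω', F ω' ∂X.P (ω n)) ∂X.P z
      = ∫⁻ ω in B ∩ {ω : ℕ → E | ω n = w}, (∫⁻ ω', F ω' ∂X.P w) ∂X.P z := by
    refine setLIntegral_congr_fun (hm w) ?_
    rintro ω ⟨-, h⟩
    have h : ω n = w := h
    simp only [h]
  rw [this, lintegral_const, Measure.restrict_apply_univ, smul_eq_mul, mul_comm]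

theorem measure_inter_shift (X : MChain E) (z : E) (n : ℕ) {B : Set (ℕ → E)}
    (hB : MeasurableSet B)
    (hBn : ∀ ω ω' : ℕ → E, (∀ k, k ≤ n → ω k = ω' k) → ω ∈ B → ω' ∈ B)
    {A : Set (ℕ → E)} (hA : MeasurableSet A) :
    X.P z (B ∩ {ω | (fun k => ω (n + k)) ∈ A}) = ∫⁻ ω in B, X.P (ω n) A ∂X.P z := by
  have hshift : Measurable (fun ω : ℕ → E => fun k => ω (n + k)) :=
    measurable_pi_lambda _ fun k => measurable_pi_apply _
  have h := X.setLIntegral_shift z n hB hBn (F := A.indicator 1) (measurable_one.indicator hA)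
  simp only [lintegral_indicator_one hA] at h
  rw [← h, Set.inter_comm]
  refine (Measure.restrict_apply (hshift hA)).symm.trans ?_
  exact (lintegral_indicator_one (hshift hA)).symm

end MChain

omit [Nonempty S] [MeasurableSpace S] [MeasurableSingletonClass S] in
theorem IsStochasticMatrix.pow_nonneg {Q : S → S → ℝ} (hQ : IsStochasticMatrix Q) (n : ℕ)
    (i j : S) : 0 ≤ ((Matrix.of Q) ^ n) i j := by
  induction n generalizing i j with
  | zero => rw [pow_zero, Matrix.one_apply]; split_ifs <;> norm_num
  | succ n ih =>
    rw [pow_succ, Matrix.mul_apply]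
    exact Finset.sum_nonneg fun l _ => mul_nonneg (ih i l) (hQ.1 l j)

omit [DecidableEq S] [Nonempty S] [MeasurableSpace S] [MeasurableSingletonClass S] in
theorem IsStochasticMatrix.le_one {Q : S → S → ℝ} (hQ : IsStochasticMatrix Q) (i j : S) :
    Q i j ≤ 1 :=
  (Finset.single_le_sum (fun l _ => hQ.1 i l) (Finset.mem_univ j)).trans_eq (hQ.2 i)

omit [Nonempty S] [MeasurableSpace S] [MeasurableSingletonClass S] in
theorem IsIrreducibleMatrix.eq_zero_of_invariant {Q : S → S → ℝ} (hQ : IsStochasticMatrix Q)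
    (hirr : IsIrreducibleMatrix Q) {v : S → ℝ} (hv : ∀ j, v j = ∑ l, v l * Q l j) {s0 : S}
    (h0 : v s0 = 0) : v = 0 := by
  have hle : ∀ j, |v j| ≤ ∑ l, |v l| * Q l j := fun j => by
    calc |v j| = |∑ l, v l * Q l j| := by rw [← hv j]
      _ ≤ ∑ l, |v l * Q l j| := Finset.abs_sum_le_sum_abs _ _
      _ = _ := by simp only [abs_mul, abs_of_nonneg (hQ.1 _ _)]
  have hsum : ∑ j, |v j| = ∑ j, ∑ l, |v l| * Q l j := by
    rw [Finset.sum_comm]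
    simp only [← Finset.mul_sum, hQ.2, mul_one]
  have heq : ∀ j, |v j| = ∑ l, |v l| * Q l j := fun j =>
    (Finset.sum_eq_sum_iff_of_le fun j _ => hle j).1 hsum j (Finset.mem_univ j)
  have hpow : ∀ n : ℕ, ∀ j, |v j| = ∑ l, |v l| * ((Matrix.of Q) ^ n) l j := by
    intro n
    induction n with
    | zero => intro j; simp [Matrix.one_apply]
    | succ n ih =>
      intro j
      rw [heq j]
      simp only [pow_succ, Matrix.mul_apply, Matrix.of_apply, Finset.mul_sum]
      rw [Finset.sum_comm]
      refine Finset.sum_congr rfl fun m _ => ?_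
      rw [ih m, Finset.sum_mul]
      exact Finset.sum_congr rfl fun l _ => by ring
  funext i
  obtain ⟨n, hn⟩ := hirr i s0
  have h1 := hpow n s0
  rw [h0, abs_zero] at h1
  have h2 := (Finset.sum_eq_zero_iff_of_nonneg
    fun l _ => mul_nonneg (abs_nonneg (v l)) (hQ.pow_nonneg n l s0)).1 h1.symm i (Finset.mem_univ i)
  simpa [hn.ne'] using h2

omit [Nonempty S] [MeasurableSpace S] [MeasurableSingletonClass S] in
theorem IsIrreducibleMatrix.exists_abs_le {Q : S → S → ℝ} (hQ : IsStochasticMatrix Q)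
    (hirr : IsIrreducibleMatrix Q) (s0 : S) :
    ∃ K : ℝ, 0 < K ∧ ∀ (v : S → ℝ) (r : ℝ), v s0 = 0 →
      (∀ j, |v j - ∑ l, v l * Q l j| ≤ r) → ∀ j, |v j| ≤ K * r := by
  let L : (S → ℝ) →ₗ[ℝ] (S → ℝ) × ℝ :=
    { toFun := fun v => (fun j => v j - ∑ l, v l * Q l j, v s0)
      map_add' := fun v w => by
        ext <;> simp [add_mul, Finset.sum_add_distrib]
        ring
      map_smul' := fun c v => by
        ext <;> simp [mul_assoc, ← Finset.mul_sum, mul_sub] }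
  have hker : LinearMap.ker L = ⊥ := by
    rw [LinearMap.ker_eq_bot']
    intro v hv
    have h1 : (fun j => v j - ∑ l, v l * Q l j) = 0 := congrArg Prod.fst hv
    exact hirr.eq_zero_of_invariant hQ (fun j => sub_eq_zero.1 (congrFun h1 j))
      (congrArg Prod.snd hv : v s0 = 0)
  obtain ⟨K, hK, hL⟩ := L.exists_antilipschitzWith hker
  refine ⟨K, hK, fun v r h0 hr j => ?_⟩
  have hr0 : 0 ≤ r := (abs_nonneg _).trans (hr j)
  have h := hL.le_mul_dist v 0
  rw [dist_zero_right, map_zero, dist_zero_right] at h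
  refine (norm_le_pi_norm v j).trans (h.trans ?_)
  gcongr
  refine (norm_prod_le_iff).2 ⟨(pi_norm_le_iff_of_nonneg hr0).2 hr, ?_⟩
  simpa [L, h0] using hr0

omit [DecidableEq S] [Nonempty S] in
theorem CondB.exists_lintegral_displacement_le {X : MChain (ℕ × S)} {p : ℝ} (hp : 1 < p)
    (hB : CondB X p) :
    ∃ C : ℝ≥0, ∀ (x : ℕ) (i : S) (k : ℕ),
      ∫⁻ ω, ENNReal.ofReal |((ω k).1 : ℝ) - (x : ℝ)| ∂X.P (x, i) ≤ k * C := by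
  obtain ⟨C₀, hC₀, hB⟩ := hB
  lift C₀ to ℝ≥0 using hC₀
  have hmeas : ∀ (k : ℕ) (f : ℕ × S → ℝ≥0∞), Measurable fun ω : ℕ → ℕ × S => f (ω k) :=
    fun k f => (measurable_of_countable f).comp (measurable_pi_apply k)
  have hstep : ∀ (x : ℕ) (i : S),
      ∫⁻ ω, ENNReal.ofReal |((ω 1).1 : ℝ) - (x : ℝ)| ∂X.P (x, i) ≤ (1 + C₀ : ℝ≥0) := by
    intro x i
    calc ∫⁻ ω, ENNReal.ofReal |((ω 1).1 : ℝ) - (x : ℝ)| ∂X.P (x, i)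
        ≤ ∫⁻ ω, (1 + ENNReal.ofReal (|((ω 1).1 : ℝ) - (x : ℝ)| ^ p)) ∂X.P (x, i) := by
          refine lintegral_mono fun ω => ?_
          rw [← ENNReal.ofReal_one, ← ENNReal.ofReal_add zero_le_one (by positivity)]
          refine ENNReal.ofReal_le_ofReal ?_
          rcases le_total |((ω 1).1 : ℝ) - (x : ℝ)| 1 with h | h
          · exact h.trans (le_add_of_nonneg_right (by positivity))
          · exact (Real.self_le_rpow_of_one_le h hp.le).trans (by linarith)
      _ ≤ _ := by
          rw [lintegral_add_left measurable_const, lintegral_one, measure_univ]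
          push_cast
          gcongr
          exact hB x i
  refine ⟨1 + C₀, fun x i k => ?_⟩
  induction k with
  | zero =>
    rw [lintegral_congr_ae (g := fun _ => 0)]
    · simp
    · filter_upwards [X.ae_init_s10 (x, i)] with ω hω
      simp [hω]
  | succ k ih =>
    have hF : Measurable fun ω : ℕ → ℕ × S =>
        ENNReal.ofReal |((ω 1).1 : ℝ) - ((ω 0).1 : ℝ)| :=
      MChain.measurable_comp_eval_pair (fun q : (ℕ × S) × (ℕ × S) =>
        ENNReal.ofReal |(q.2.1 : ℝ) - (q.1.1 : ℝ)|) 0 1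
    have hshift := X.setLIntegral_shift (x, i) k MeasurableSet.univ
      (fun _ _ _ _ => Set.mem_univ _) hF
    simp only [Measure.restrict_univ, add_zero] at hshift
    have hincr : ∀ w : ℕ × S,
        ∫⁻ ω, ENNReal.ofReal |((ω 1).1 : ℝ) - ((ω 0).1 : ℝ)| ∂X.P w ≤ (1 + C₀ : ℝ≥0) := by
      intro w
      refine le_trans (le_of_eq (lintegral_congr_ae ?_)) (hstep w.1 w.2)
      filter_upwards [X.ae_init_s10 w] with ω hω
      rw [hω]
    calc ∫⁻ ω, ENNReal.ofReal |((ω (k + 1)).1 : ℝ) - (x : ℝ)| ∂X.P (x, i)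
        ≤ ∫⁻ ω, (ENNReal.ofReal |((ω k).1 : ℝ) - (x : ℝ)|
            + ENNReal.ofReal |((ω (k + 1)).1 : ℝ) - ((ω k).1 : ℝ)|) ∂X.P (x, i) := by
          refine lintegral_mono fun ω => ?_
          rw [← ENNReal.ofReal_add (abs_nonneg _) (abs_nonneg _)]
          refine ENNReal.ofReal_le_ofReal ?_
          rw [add_comm |((ω k).1 : ℝ) - x|]
          exact abs_sub_le ((ω (k + 1)).1 : ℝ) ((ω k).1 : ℝ) (x : ℝ)
      _ ≤ k * (1 + C₀ : ℝ≥0) + (1 + C₀ : ℝ≥0) := by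
          rw [lintegral_add_left (hmeas k fun q => ENNReal.ofReal |(q.1 : ℝ) - (x : ℝ)|), hshift]
          gcongr
          refine (lintegral_mono fun ω : ℕ → ℕ × S => hincr (ω k)).trans ?_
          simp
      _ = _ := by push_cast; ring

omit [DecidableEq S] [Nonempty S] in
theorem CondB.exists_prob_low_le {X : MChain (ℕ × S)} {p : ℝ} (hp : 1 < p) (hB : CondB X p) :
    ∃ C : ℝ, 0 ≤ C ∧ ∀ (x : ℕ) (i : S) (k : ℕ), 1 ≤ x →
      (X.P (x, i)).real {ω | 2 * (ω k).1 < x} ≤ C * k / x := by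
  obtain ⟨C, hC⟩ := hB.exists_lintegral_displacement_le hp
  refine ⟨2 * C, by positivity, fun x i k hx => ?_⟩
  have hx0 : (0 : ℝ) < x := by exact_mod_cast hx
  have hmeas : Measurable fun ω : ℕ → ℕ × S => ENNReal.ofReal |((ω k).1 : ℝ) - (x : ℝ)| :=
    (measurable_of_countable fun q : ℕ × S => ENNReal.ofReal |(q.1 : ℝ) - (x : ℝ)|).comp
      (measurable_pi_apply k)
  have h1 : ENNReal.ofReal (x / 2) * X.P (x, i) {ω | 2 * (ω k).1 < x} ≤ k * C := by
    refine le_trans ?_ ((mul_meas_ge_le_lintegral hmeas (ENNReal.ofReal (x / 2))).trans (hC x i k))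
    gcongr with ω
    intro hω
    have hω : (2 * (ω k).1 : ℝ) < x := by exact_mod_cast (hω : 2 * (ω k).1 < x)
    refine ENNReal.ofReal_le_ofReal ?_
    rw [abs_sub_comm]
    exact le_trans (by linarith) (le_abs_self _)
  have h2 := ENNReal.toReal_mono (by finiteness) h1
  simp only [ENNReal.toReal_mul, ENNReal.toReal_ofReal (half_pos hx0).le, ENNReal.toReal_natCast,
    ENNReal.coe_toReal] at h2
  rw [le_div_iff₀ hx0, Measure.real]
  linarith

/-- The event that the `S`-coordinate does not visit `s0` at any of the times `1, …, k`. -/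
def avoidUpTo (s0 : S) (k : ℕ) : Set (ℕ → ℕ × S) := {ω | ∀ m, 1 ≤ m → m ≤ k → (ω m).2 ≠ s0}

/-- The event that the `S`-coordinate visits `s0` at some time in `0, …, n`. -/
def hitBy (s0 : S) (n : ℕ) : Set (ℕ → ℕ × S) := {ω | ∃ m ≤ n, (ω m).2 = s0}

omit [DecidableEq S] [Nonempty S] in
theorem measurableSet_eval (k : ℕ) (s : Set (ℕ × S)) :
    MeasurableSet {ω : ℕ → ℕ × S | ω k ∈ s} :=
  measurable_pi_apply (X := fun _ : ℕ => ℕ × S) k s.to_countable.measurableSet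

omit [DecidableEq S] [Nonempty S] in
theorem measurableSet_avoidUpTo (s0 : S) (k : ℕ) : MeasurableSet (avoidUpTo s0 k) := by
  simp only [avoidUpTo, Set.ofPred_forall]
  exact MeasurableSet.iInter fun m => MeasurableSet.iInter fun _ => MeasurableSet.iInter fun _ =>
    measurableSet_eval m {q | q.2 ≠ s0}

omit [DecidableEq S] [Nonempty S] in
theorem measurableSet_hitBy (s0 : S) (n : ℕ) : MeasurableSet (hitBy s0 n) := by
  have : hitBy s0 n = ⋃ m, ⋃ _ : m ≤ n, {ω : ℕ → ℕ × S | ω m ∈ {q : ℕ × S | q.2 = s0}} := by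
    ext ω; simp [hitBy]
  rw [this]
  exact MeasurableSet.iUnion fun m => MeasurableSet.iUnion fun _ => measurableSet_eval m _

omit [Fintype S] [DecidableEq S] [Nonempty S] [MeasurableSpace S] [MeasurableSingletonClass S] in
theorem hitBy_mono (s0 : S) : Monotone (hitBy s0) :=
  fun _ _ h _ ⟨m, hm, hω⟩ => ⟨m, hm.trans h, hω⟩

omit [Fintype S] [DecidableEq S] [Nonempty S] [MeasurableSpace S] [MeasurableSingletonClass S] in
theorem avoidUpTo_anti (s0 : S) : Antitone (avoidUpTo s0) :=
  fun _ _ h _ hω m h1 hm => hω m h1 (hm.trans h)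

omit [Fintype S] [DecidableEq S] [Nonempty S] [MeasurableSpace S] [MeasurableSingletonClass S] in
theorem avoidUpTo_congr (s0 : S) (k : ℕ) (ω ω' : ℕ → ℕ × S) (h : ∀ m, m ≤ k → ω m = ω' m)
    (hω : ω ∈ avoidUpTo s0 k) : ω' ∈ avoidUpTo s0 k :=
  fun m h1 hm => h m hm ▸ hω m h1 hm

omit [DecidableEq S] [Nonempty S] in
theorem lintegral_hitBy_le (X : MChain (ℕ × S)) (s0 : S) (z : ℕ × S) (n : ℕ) :
    ∫⁻ ω, X.P (ω 1) (hitBy s0 n) ∂X.P z ≤ X.P z (avoidUpTo s0 (n + 1))ᶜ := by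
  have h := X.measure_inter_shift z 1 MeasurableSet.univ (fun _ _ _ h => h)
    (measurableSet_hitBy s0 n)
  rw [Measure.restrict_univ, Set.univ_inter] at h
  rw [← h]
  refine measure_mono ?_
  rintro ω ⟨m, hm, hω⟩ hav
  exact hav (1 + m) (by omega) (by omega) hω

omit [Nonempty S] in
theorem exists_le_prob_hitBy {X : MChain (ℕ × S)} {p : ℝ} (hp : 1 < p) (hB : CondB X p)
    {Q : S → S → ℝ} (hQ : CondQ X Q) (s0 : S) (n : ℕ) (i : S)
    (hn : 0 < ((Matrix.of Q) ^ n) i s0) :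
    ∃ (N x₀ : ℕ) (ε : ℝ≥0∞), 0 < ε ∧ ∀ x, x₀ ≤ x → ε ≤ X.P (x, i) (hitBy s0 N) := by
  induction n generalizing i with
  | zero =>
    have hi : i = s0 := by
      by_contra h
      simp [h] at hn
    subst hi
    refine ⟨0, 0, 1, one_pos, fun x _ => ?_⟩
    rw [← X.init (x, i)]
    refine measure_mono fun ω hω => ⟨0, le_rfl, ?_⟩
    rw [show ω 0 = (x, i) from hω]
  | succ n ih =>
    obtain ⟨j, hj⟩ : ∃ j, 0 < Q i j * ((Matrix.of Q) ^ n) j s0 := by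
      by_contra! h
      rw [pow_succ', Matrix.mul_apply] at hn
      exact hn.not_ge (Finset.sum_nonpos fun j _ => h j)
    have hQij : 0 < Q i j := pos_of_mul_pos_left hj (hQ.2.1.pow_nonneg n j s0)
    obtain ⟨N, x₀, ε, hε, hN⟩ := ih j (pos_of_mul_pos_right hj hQij.le)
    obtain ⟨C, -, hC⟩ := hB.exists_prob_low_le hp
    have hlim : Tendsto (fun x : ℕ => qhat X x i j - C * (1 : ℕ) / x) atTop (𝓝 (Q i j - 0)) :=
      (hQ.1 i j).sub (tendsto_const_div_atTop_nhds_zero_nat _)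
    rw [sub_zero] at hlim
    obtain ⟨x₁, hx₁⟩ := eventually_atTop.1 (hlim.eventually_const_lt (half_lt_self hQij))
    refine ⟨N + 1, max (max (2 * x₀) x₁) 1, ε * ENNReal.ofReal (Q i j / 2),
      ENNReal.mul_pos hε.ne' (by simpa using hQij), fun x hx => ?_⟩
    have hx₀ : 2 * x₀ ≤ x := (le_max_left _ _).trans ((le_max_left _ _).trans hx)
    have hx1 : x₁ ≤ x := (le_max_right _ _).trans ((le_max_left _ _).trans hx)
    have hxpos : 1 ≤ x := (le_max_right _ _).trans hx
    set G : Set (ℕ → ℕ × S) := {ω | ω 1 ∈ {q : ℕ × S | q.2 = j ∧ x₀ ≤ q.1}} with hG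
    have hGm : MeasurableSet G := measurableSet_eval 1 _
    have hGp : Q i j / 2 ≤ (X.P (x, i)).real G := by
      have hsub : {ω : ℕ → ℕ × S | (ω 1).2 = j} ⊆ G ∪ {ω | 2 * (ω 1).1 < x} := by
        intro ω hω
        by_cases h : 2 * (ω 1).1 < x
        · exact Or.inr h
        · exact Or.inl ⟨hω, by omega⟩
      have h1 : qhat X x i j ≤ (X.P (x, i)).real G
          + (X.P (x, i)).real {ω | 2 * (ω 1).1 < x} :=
        (measureReal_mono hsub).trans (measureReal_union_le _ _)
      have h2 := hC x i 1 hxpos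
      have h3 := hx₁ x hx1
      linarith
    calc ε * ENNReal.ofReal (Q i j / 2) ≤ ε * X.P (x, i) G := by
          gcongr
          exact ENNReal.ofReal_le_of_le_toReal hGp
      _ = ∫⁻ ω, G.indicator (fun _ => ε) ω ∂X.P (x, i) := (lintegral_indicator_const hGm ε).symm
      _ ≤ ∫⁻ ω, X.P (ω 1) (hitBy s0 N) ∂X.P (x, i) := by
          refine lintegral_mono fun ω => Set.indicator_apply_le' (fun h => ?_) fun _ => zero_le
          obtain ⟨h1, h2⟩ := h
          have := hN _ h2
          rwa [← h1] at this
      _ ≤ X.P (x, i) (avoidUpTo s0 (N + 1))ᶜ := lintegral_hitBy_le X s0 _ N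
      _ ≤ X.P (x, i) (hitBy s0 (N + 1)) := by
          refine measure_mono fun ω hω => ?_
          simp only [avoidUpTo, Set.mem_compl_iff, Set.mem_ofPred_eq, not_forall, not_not] at hω
          obtain ⟨m, -, hm, h⟩ := hω
          exact ⟨m, hm, h⟩

omit [Nonempty S] in
theorem exists_uniform_prob_hitBy {X : MChain (ℕ × S)} (hirr : X.Irreducible) {p : ℝ}
    (hp : 1 < p) (hB : CondB X p) {Q : S → S → ℝ} (hQ : CondQ X Q) (s0 : S) :
    ∃ (N : ℕ) (ε : ℝ≥0∞), 0 < ε ∧ ∀ z, ε ≤ X.P z (hitBy s0 N) := by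
  have hlarge : ∀ i : S, ∃ (N x₀ : ℕ) (ε : ℝ≥0∞), 0 < ε ∧
      ∀ x, x₀ ≤ x → ε ≤ X.P (x, i) (hitBy s0 N) := fun i => by
    obtain ⟨n, hn⟩ := hQ.2.2 i s0
    exact exists_le_prob_hitBy hp hB hQ s0 n i hn
  have hpos : ∀ z, ∃ N, 0 < X.P z (hitBy s0 N) := fun z => by
    obtain ⟨n, hn⟩ := hirr z (0, s0)
    refine ⟨n, (pos_iff_ne_zero.2 hn).trans_le (measure_mono fun ω hω => ⟨n, le_rfl, ?_⟩)⟩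
    rw [show ω n = (0, s0) from hω]
  choose M x₀ ε hε hM using hlarge
  choose N hN using hpos
  let Z : Finset (ℕ × S) := Finset.range (Finset.univ.sup x₀) ×ˢ Finset.univ
  refine ⟨max (Finset.univ.sup M) (Z.sup N),
    min (Finset.univ.inf ε) (Z.inf fun z => X.P z (hitBy s0 (N z))), lt_min ?_ ?_, fun z => ?_⟩
  · exact (Finset.lt_inf_iff ENNReal.zero_lt_top).2 fun i _ => hε i
  · exact (Finset.lt_inf_iff ENNReal.zero_lt_top).2 fun z _ => hN z
  · by_cases hz : x₀ z.2 ≤ z.1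
    · refine (min_le_left _ _).trans ((Finset.inf_le (Finset.mem_univ z.2)).trans
        ((hM z.2 z.1 hz).trans (measure_mono (hitBy_mono s0 ?_))))
      exact (Finset.le_sup (Finset.mem_univ z.2)).trans (le_max_left _ _)
    · have hzZ : z ∈ Z := by
        simp only [Z, Finset.mem_product, Finset.mem_range, Finset.mem_univ, and_true]
        exact (not_le.1 hz).trans_le (Finset.le_sup (Finset.mem_univ z.2))
      refine (min_le_right _ _).trans ((Finset.inf_le hzZ).trans
        (measure_mono (hitBy_mono s0 ?_)))
      exact (Finset.le_sup hzZ).trans (le_max_right _ _)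

omit [Nonempty S] in
theorem exists_prob_avoidUpTo_le {X : MChain (ℕ × S)} (hirr : X.Irreducible) {p : ℝ}
    (hp : 1 < p) (hB : CondB X p) {Q : S → S → ℝ} (hQ : CondQ X Q) (s0 : S) :
    ∃ C ρ : ℝ, 0 ≤ C ∧ 0 ≤ ρ ∧ ρ < 1 ∧
      ∀ z k, (X.P z).real (avoidUpTo s0 k) ≤ C * ρ ^ k := by
  obtain ⟨N, ε, hε, hN⟩ := exists_uniform_prob_hitBy hirr hp hB hQ s0
  obtain ⟨θ, hθ0, hθ1, hθ⟩ : ∃ θ : ℝ, 0 < θ ∧ θ < 1 ∧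
      ∀ z, X.P z (avoidUpTo s0 (N + 1)) ≤ ENNReal.ofReal θ := by
    have hlt : 1 - ε < 1 := ENNReal.sub_lt_self ENNReal.one_ne_top one_ne_zero hε.ne'
    obtain ⟨t, ht1, ht2⟩ := exists_between hlt
    have htt : t ≠ ⊤ := (ht2.trans ENNReal.one_lt_top).ne
    refine ⟨t.toReal, ENNReal.toReal_pos ((zero_le).trans_lt ht1).ne' htt, ?_, fun z => ?_⟩
    · simpa using (ENNReal.toReal_lt_toReal htt ENNReal.one_ne_top).2 ht2
    · rw [ENNReal.ofReal_toReal htt]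
      refine le_trans ?_ ht1.le
      have h1 : ε ≤ X.P z (avoidUpTo s0 (N + 1))ᶜ := by
        refine le_trans ?_ (lintegral_hitBy_le X s0 z N)
        calc ε = ∫⁻ _, ε ∂X.P z := by simp
          _ ≤ _ := lintegral_mono fun ω => hN (ω 1)
      rw [← compl_compl (avoidUpTo s0 (N + 1)),
        prob_compl_eq_one_sub (measurableSet_avoidUpTo s0 _).compl]
      exact tsub_le_tsub_left h1 1
  have hpow : ∀ z m, X.P z (avoidUpTo s0 ((N + 1) * m)) ≤ ENNReal.ofReal (θ ^ m) := by
    intro z m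
    induction m with
    | zero => simpa using prob_le_one
    | succ m ih =>
      have h := X.measure_inter_shift z ((N + 1) * m) (measurableSet_avoidUpTo s0 _)
        (avoidUpTo_congr s0 _) (measurableSet_avoidUpTo s0 (N + 1))
      have hsub : avoidUpTo s0 ((N + 1) * (m + 1)) ⊆ avoidUpTo s0 ((N + 1) * m) ∩
          {ω | (fun k => ω ((N + 1) * m + k)) ∈ avoidUpTo s0 (N + 1)} := fun ω hω =>
        ⟨avoidUpTo_anti s0 (by gcongr; omega) hω, fun k h1 hk =>
          hω _ (by omega) (by rw [mul_add, mul_one]; omega)⟩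
      calc X.P z (avoidUpTo s0 ((N + 1) * (m + 1)))
          ≤ ∫⁻ ω in avoidUpTo s0 ((N + 1) * m), X.P (ω ((N + 1) * m)) (avoidUpTo s0 (N + 1))
              ∂X.P z := (measure_mono hsub).trans h.le
        _ ≤ ∫⁻ ω in avoidUpTo s0 ((N + 1) * m), ENNReal.ofReal θ ∂X.P z :=
            lintegral_mono fun ω => hθ _
        _ ≤ ENNReal.ofReal θ * ENNReal.ofReal (θ ^ m) := by
            rw [setLIntegral_const]; gcongr
        _ = ENNReal.ofReal (θ ^ (m + 1)) := by
            rw [← ENNReal.ofReal_mul hθ0.le, pow_succ']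
  set ρ : ℝ := θ ^ ((N + 1 : ℕ) : ℝ)⁻¹ with hρdef
  have hρ0 : 0 ≤ ρ := Real.rpow_nonneg hθ0.le _
  have hρ1 : ρ < 1 := Real.rpow_lt_one hθ0.le hθ1 (by positivity)
  have hρN : ρ ^ (N + 1) = θ := Real.rpow_inv_natCast_pow hθ0.le (by omega)
  refine ⟨θ⁻¹, ρ, by positivity, hρ0, hρ1, fun z k => ?_⟩
  have hk := Nat.div_add_mod k (N + 1)
  have hk' := Nat.mod_lt k (show 0 < N + 1 by omega)
  calc (X.P z).real (avoidUpTo s0 k) ≤ (X.P z).real (avoidUpTo s0 ((N + 1) * (k / (N + 1)))) :=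
        measureReal_mono (avoidUpTo_anti s0 (by omega))
    _ ≤ θ ^ (k / (N + 1)) := ENNReal.toReal_le_of_le_ofReal (by positivity) (hpow z _)
    _ = θ⁻¹ * ρ ^ ((N + 1) * (k / (N + 1) + 1)) := by
        rw [pow_mul, hρN, pow_succ]; field_simp
    _ ≤ θ⁻¹ * ρ ^ k := by
        gcongr θ⁻¹ * ?_
        refine pow_le_pow_of_le_one hρ0 hρ1.le ?_
        rw [mul_add, mul_one]
        omega

omit [Fintype S] [Nonempty S] [DecidableEq S] [MeasurableSpace S] [MeasurableSingletonClass S] in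
theorem lt_tauRet_iff {s0 : S} {ω : ℕ → ℕ × S} (hω : ∃ k, ω ∉ avoidUpTo s0 k) (k : ℕ) :
    k < tauRet s0 ω ↔ ω ∈ avoidUpTo s0 k := by
  have hne : {n | 1 ≤ n ∧ (ω n).2 = s0}.Nonempty := by
    obtain ⟨k, hk⟩ := hω
    simp only [avoidUpTo, Set.mem_ofPred_eq, not_forall, not_not] at hk
    obtain ⟨m, h1, -, h⟩ := hk
    exact ⟨m, h1, h⟩
  constructor
  · intro h m h1 hm hs
    have : tauRet s0 ω ≤ m := Nat.sInf_le ⟨h1, hs⟩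
    omega
  · intro h
    by_contra hlt
    obtain ⟨h1, hs⟩ := Nat.sInf_mem hne
    exact h _ h1 (not_lt.1 hlt) hs

omit [Nonempty S] in
theorem hasSum_occupation (X : MChain (ℕ × S)) (s0 : S) (z : ℕ × S)
    (hsum : Summable fun k => (X.P z).real (avoidUpTo s0 k)) (i : S) :
    HasSum (fun k => (X.P z).real (avoidUpTo s0 k ∩ {ω | (ω k).2 = i}))
      (∫ ω, (∑ k ∈ Finset.range (tauRet s0 ω), if (ω k).2 = i then (1:ℝ) else 0) ∂X.P z) := by
  have hm : ∀ k, MeasurableSet (avoidUpTo s0 k ∩ {ω | (ω k).2 = i}) := fun k =>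
    (measurableSet_avoidUpTo s0 k).inter (measurableSet_eval k {q | q.2 = i})
  have hnorm : ∀ k (ω : ℕ → ℕ × S),
      ‖(avoidUpTo s0 k ∩ {ω | (ω k).2 = i}).indicator (1 : (ℕ → ℕ × S) → ℝ) ω‖
        = (avoidUpTo s0 k ∩ {ω | (ω k).2 = i}).indicator 1 ω := fun k ω =>
    Real.norm_of_nonneg (Set.indicator_nonneg (fun _ _ => zero_le_one) ω)
  have h := hasSum_integral_of_summable_integral_norm (μ := X.P z)
    (F := fun k => (avoidUpTo s0 k ∩ {ω | (ω k).2 = i}).indicator (1 : (ℕ → ℕ × S) → ℝ))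
    (fun k => (integrable_const 1).indicator (hm k)) (by
      simp only [hnorm, integral_indicator_one (hm _)]
      exact hsum.of_nonneg_of_le (fun _ => measureReal_nonneg)
        fun k => measureReal_mono Set.inter_subset_left)
  simp only [integral_indicator_one (hm _)] at h
  have hae : ∀ᵐ ω ∂X.P z, ∃ k, ω ∉ avoidUpTo s0 k := by
    have h0 : X.P z (⋂ k, avoidUpTo s0 k) = 0 := by
      have h1 : (X.P z).real (⋂ k, avoidUpTo s0 k) ≤ 0 :=
        ge_of_tendsto' hsum.tendsto_atTop_zero fun k => measureReal_mono (Set.iInter_subset _ k)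
      exact (measureReal_eq_zero_iff).1 (le_antisymm h1 measureReal_nonneg)
    filter_upwards [measure_eq_zero_iff_ae_notMem.1 h0] with ω hω
    simpa using hω
  refine (congrArg (HasSum _) (integral_congr_ae ?_)).mpr h
  filter_upwards [hae] with ω hω
  rw [tsum_eq_sum (s := Finset.range (tauRet s0 ω))]
  · refine Finset.sum_congr rfl fun k hk => ?_
    have hk' := (lt_tauRet_iff hω k).1 (Finset.mem_range.1 hk)
    by_cases hi : (ω k).2 = i <;> simp [Set.indicator, hk', hi]
  · intro k hk
    have hk' : ω ∉ avoidUpTo s0 k := fun h => hk (Finset.mem_range.2 ((lt_tauRet_iff hω k).2 h))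
    simp [Set.indicator, hk']

omit [Fintype S] [DecidableEq S] [Nonempty S] [MeasurableSingletonClass S] in
theorem qhat_mem_Icc (X : MChain (ℕ × S)) (x : ℕ) (i j : S) : qhat X x i j ∈ Set.Icc (0:ℝ) 1 :=
  ⟨measureReal_nonneg, measureReal_le_one⟩

omit [DecidableEq S] [Nonempty S] in
theorem measureReal_avoidUpTo_inter_next (X : MChain (ℕ × S)) (s0 : S) (z : ℕ × S) (k : ℕ)
    (j : S) :
    (X.P z).real (avoidUpTo s0 k ∩ {ω | (ω (k + 1)).2 = j})
      = ∫ ω in avoidUpTo s0 k, qhat X (ω k).1 (ω k).2 j ∂X.P z := by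
  have h := X.measure_inter_shift z k (measurableSet_avoidUpTo s0 k) (avoidUpTo_congr s0 k)
    (measurableSet_eval 1 {q | q.2 = j})
  have hm : Measurable fun ω : ℕ → ℕ × S => X.P (ω k) {ω' | (ω' 1).2 = j} :=
    (measurable_of_countable fun w => X.P w {ω' | (ω' 1).2 = j}).comp (measurable_pi_apply k)
  have h2 := integral_toReal (μ := (X.P z).restrict (avoidUpTo s0 k)) hm.aemeasurable
    (Eventually.of_forall fun ω => measure_lt_top _ _)
  rw [Measure.real]
  exact (congrArg ENNReal.toReal h).trans h2.symm

omit [Nonempty S] in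
theorem sum_measureReal_mul_eq_setIntegral (X : MChain (ℕ × S)) (s0 : S) (z : ℕ × S) (k : ℕ)
    (f : S → ℝ) :
    ∑ l, (X.P z).real (avoidUpTo s0 k ∩ {ω | (ω k).2 = l}) * f l
      = ∫ ω in avoidUpTo s0 k, f (ω k).2 ∂X.P z := by
  have hm : ∀ l : S, MeasurableSet {ω : ℕ → ℕ × S | (ω k).2 = l} := fun l =>
    measurableSet_eval k {q | q.2 = l}
  have hf : ∀ ω : ℕ → ℕ × S,
      f (ω k).2 = ∑ l, {ω : ℕ → ℕ × S | (ω k).2 = l}.indicator (fun _ => f l) ω := by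
    intro ω
    simp [Set.indicator]
  simp only [hf]
  rw [integral_finsetSum _ fun l _ => (integrable_const (f l)).indicator (hm l)]
  refine Finset.sum_congr rfl fun l _ => ?_
  rw [integral_indicator_const _ (hm l), measureReal_restrict_apply (hm l), Set.inter_comm,
    smul_eq_mul]

omit [Nonempty S] in
theorem abs_next_sub_sum_le (X : MChain (ℕ × S)) {Q : S → S → ℝ} (hQ : IsStochasticMatrix Q)
    (s0 : S) (z : ℕ × S) (k : ℕ) (j : S) (x : ℕ) {r : ℝ} (hr0 : 0 ≤ r)
    (hr : ∀ y : ℕ, x ≤ 2 * y → ∀ l j, |qhat X y l j - Q l j| ≤ r) :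
    |(X.P z).real (avoidUpTo s0 k ∩ {ω | (ω (k + 1)).2 = j})
        - ∑ l, (X.P z).real (avoidUpTo s0 k ∩ {ω | (ω k).2 = l}) * Q l j|
      ≤ r * (X.P z).real (avoidUpTo s0 k)
        + (X.P z).real (avoidUpTo s0 k ∩ {ω | 2 * (ω k).1 < x}) := by
  have hlow : MeasurableSet {ω : ℕ → ℕ × S | 2 * (ω k).1 < x} :=
    measurableSet_eval k {q | 2 * q.1 < x}
  have hone : ∀ y l, |qhat X y l j - Q l j| ≤ 1 := fun y l => by
    have h1 := qhat_mem_Icc X y l j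
    have h2 := hQ.1 l j
    have h3 := hQ.le_one l j
    rw [abs_le]
    constructor <;> linarith [h1.1, h1.2]
  have hmeas : ∀ g : ℕ × S → ℝ, Measurable fun ω : ℕ → ℕ × S => g (ω k) := fun g =>
    (measurable_of_countable g).comp (measurable_pi_apply k)
  have hint1 : Integrable (fun ω => qhat X (ω k).1 (ω k).2 j)
      ((X.P z).restrict (avoidUpTo s0 k)) := by
    refine Integrable.of_bound (hmeas fun w => qhat X w.1 w.2 j).aestronglyMeasurable 1
      (Eventually.of_forall fun ω => ?_)
    have h1 := qhat_mem_Icc X (ω k).1 (ω k).2 j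
    rw [Real.norm_of_nonneg h1.1]
    exact h1.2
  have hint2 : Integrable (fun ω : ℕ → ℕ × S => Q (ω k).2 j)
      ((X.P z).restrict (avoidUpTo s0 k)) := by
    refine Integrable.of_bound (hmeas fun w => Q w.2 j).aestronglyMeasurable 1
      (Eventually.of_forall fun ω => ?_)
    rw [Real.norm_of_nonneg (hQ.1 _ _)]
    exact hQ.le_one _ _
  rw [measureReal_avoidUpTo_inter_next, sum_measureReal_mul_eq_setIntegral X s0 z k fun l => Q l j,
    ← integral_sub hint1 hint2]
  refine abs_integral_le_integral_abs.trans ?_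
  calc ∫ ω in avoidUpTo s0 k, |qhat X (ω k).1 (ω k).2 j - Q (ω k).2 j| ∂X.P z
      ≤ ∫ ω in avoidUpTo s0 k,
          (r + {ω : ℕ → ℕ × S | 2 * (ω k).1 < x}.indicator (fun _ => (1 : ℝ)) ω) ∂X.P z := by
        refine integral_mono (hint1.sub hint2).abs
          ((integrable_const r).add ((integrable_const 1).indicator hlow)) fun ω => ?_
        by_cases h : 2 * (ω k).1 < x
        · have := hone (ω k).1 (ω k).2
          simp only [Set.indicator, Set.mem_ofPred_eq, h, if_true]
          linarith
        · simpa [Set.indicator, h] using hr _ (not_lt.1 h) (ω k).2 j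
    _ = _ := by
        rw [integral_add (integrable_const r) ((integrable_const 1).indicator hlow),
          integral_indicator_const _ hlow, measureReal_restrict_apply hlow, setIntegral_const,
          smul_eq_mul, smul_eq_mul, mul_one, mul_comm, Set.inter_comm]

omit [Fintype S] [DecidableEq S] [Nonempty S] [MeasurableSpace S] [MeasurableSingletonClass S] in
theorem avoidUpTo_zero (s0 : S) : avoidUpTo s0 0 = Set.univ :=
  Set.eq_univ_of_forall fun ω m h1 h2 => absurd h1 (by omega)

omit [Fintype S] [DecidableEq S] [Nonempty S] in
theorem hasSum_visit_start (X : MChain (ℕ × S)) (s0 : S) (x : ℕ) :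
    HasSum (fun k => (X.P (x, s0)).real (avoidUpTo s0 k ∩ {ω | (ω k).2 = s0})) 1 := by
  have h0 : (X.P (x, s0)).real (avoidUpTo s0 0 ∩ {ω | (ω 0).2 = s0}) = 1 := by
    rw [avoidUpTo_zero, Set.univ_inter, measureReal_congr (t := Set.univ), probReal_univ]
    filter_upwards [X.ae_init_s10 (x, s0)] with ω hω
    have : (ω 0).2 = s0 := by rw [hω]
    exact propext ⟨fun _ => trivial, fun _ => this⟩
  have hsucc : ∀ k ≠ 0, (X.P (x, s0)).real (avoidUpTo s0 k ∩ {ω | (ω k).2 = s0}) = 0 := by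
    intro k hk
    have : avoidUpTo s0 k ∩ {ω | (ω k).2 = s0} = ∅ :=
      Set.eq_empty_of_forall_notMem fun ω hω =>
        hω.1 k (Nat.one_le_iff_ne_zero.2 hk) le_rfl hω.2
    rw [this, measureReal_empty]
  simpa only [h0] using hasSum_single 0 hsucc

omit [Nonempty S] in
theorem hasSum_next (X : MChain (ℕ × S)) (s0 : S) (x : ℕ)
    (hsum : Summable fun k => (X.P (x, s0)).real (avoidUpTo s0 k)) (j : S) {a : ℝ}
    (ha : HasSum (fun k => (X.P (x, s0)).real (avoidUpTo s0 k ∩ {ω | (ω k).2 = j})) a) :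
    HasSum (fun k => (X.P (x, s0)).real (avoidUpTo s0 k ∩ {ω | (ω (k + 1)).2 = j})) a := by
  by_cases hj : j = s0
  · subst hj
    obtain rfl : a = 1 := ha.unique (hasSum_visit_start X j x)
    have hdiff : ∀ k, (X.P (x, j)).real (avoidUpTo j k ∩ {ω | (ω (k + 1)).2 = j})
        = (X.P (x, j)).real (avoidUpTo j k) - (X.P (x, j)).real (avoidUpTo j (k + 1)) := by
      intro k
      rw [← measureReal_sdiff (avoidUpTo_anti j (Nat.le_succ k)) (measurableSet_avoidUpTo j _)]
      congr 1
      ext ω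
      constructor
      · rintro ⟨h1, h2⟩
        exact ⟨h1, fun h => h (k + 1) (by omega) le_rfl h2⟩
      · rintro ⟨h1, h2⟩
        refine ⟨h1, ?_⟩
        by_contra h
        refine h2 fun m hm1 hm2 => ?_
        rcases Nat.lt_or_ge k m with hm | hm
        · obtain rfl : m = k + 1 := by omega
          exact h
        · exact h1 m hm1 hm
    simp only [hdiff]
    have hnn : ∀ k, 0 ≤ (X.P (x, j)).real (avoidUpTo j k)
        - (X.P (x, j)).real (avoidUpTo j (k + 1)) := fun k =>
      sub_nonneg.2 (measureReal_mono (avoidUpTo_anti j (Nat.le_succ k)))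
    rw [hasSum_iff_tendsto_nat_of_nonneg hnn]
    simp only [Finset.sum_range_sub', avoidUpTo_zero, probReal_univ]
    simpa using hsum.tendsto_atTop_zero.const_sub 1
  · rw [← hasSum_nat_add_iff' 1] at ha
    have h0 : (X.P (x, s0)).real (avoidUpTo s0 0 ∩ {ω | (ω 0).2 = j}) = 0 := by
      rw [avoidUpTo_zero, Set.univ_inter, measureReal_eq_zero_iff, measure_eq_zero_iff_ae_notMem]
      filter_upwards [X.ae_init_s10 (x, s0)] with ω hω h
      have h : (ω 0).2 = j := h
      rw [hω] at h
      exact hj h.symm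
    simp only [Finset.sum_range_one, h0, sub_zero] at ha
    refine ha.congr_fun fun k => congrArg (X.P (x, s0)).real (Set.ext fun ω => ?_)
    constructor
    · rintro ⟨h1, h2⟩
      refine ⟨fun m hm1 hm2 => ?_, h2⟩
      rcases Nat.lt_or_ge k m with hm | hm
      · obtain rfl : m = k + 1 := by omega
        rw [show (ω (k + 1)).2 = j from h2]
        exact hj
      · exact h1 m hm1 hm
    · rintro ⟨h1, h2⟩
      exact ⟨avoidUpTo_anti s0 (Nat.le_succ k) h1, h2⟩

theorem le_rpow_neg_half_mul_geometric {C D ρ u x : ℝ} {k : ℕ} (hC : 0 ≤ C) (hD : 0 ≤ D)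
    (hρ : 0 ≤ ρ) (hx : 0 < x) (hu0 : 0 ≤ u) (hu1 : u ≤ C * ρ ^ k) (hu2 : u ≤ D * k / x) :
    u ≤ x ^ (-(1 / 2) : ℝ) * (√(D * C) * ((k : ℝ) ^ 1 * √ρ ^ k)) := by
  have hxr : x ^ (-(1 / 2) : ℝ) = (√x)⁻¹ := by
    rw [Real.rpow_neg hx.le, Real.sqrt_eq_rpow]
  have hk : √(k : ℝ) ≤ k := by
    rcases Nat.eq_zero_or_pos k with rfl | hk
    · simp
    · have hk1 : (1 : ℝ) ≤ k := by exact_mod_cast hk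
      exact (Real.sqrt_le_left (by positivity)).2 (by nlinarith)
  have hρk : √(ρ ^ k) = √ρ ^ k := by
    rw [← Real.sqrt_sq (pow_nonneg (Real.sqrt_nonneg ρ) k), ← pow_mul, mul_comm, pow_mul,
      Real.sq_sqrt hρ]
  calc u = √(u * u) := (Real.sqrt_mul_self hu0).symm
    _ ≤ √((D * k / x) * (C * ρ ^ k)) := by gcongr
    _ = √(x⁻¹ * ((D * C) * (k * ρ ^ k))) := by congr 1; ring
    _ = (√x)⁻¹ * (√(D * C) * (√(k : ℝ) * √ρ ^ k)) := by
      rw [Real.sqrt_mul (by positivity), Real.sqrt_mul (by positivity : 0 ≤ D * C),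
        Real.sqrt_mul (Nat.cast_nonneg k), Real.sqrt_inv, hρk]
    _ ≤ _ := by rw [hxr, pow_one]; gcongr

theorem summable_geometric_add_linear_mul_geometric {ρ : ℝ} (hρ0 : 0 ≤ ρ) (hρ1 : ρ < 1)
    (C D : ℝ) : Summable fun k : ℕ => C * ρ ^ k + D * ((k : ℝ) ^ 1 * √ρ ^ k) := by
  have hσ : ‖√ρ‖ < 1 := by
    rw [Real.norm_of_nonneg (Real.sqrt_nonneg ρ), Real.sqrt_lt' one_pos]
    simpa using hρ1
  exact ((summable_geometric_of_lt_one hρ0 hρ1).mul_left C).add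
    ((summable_pow_mul_geometric_of_norm_lt_one 1 hσ).mul_left D)

omit [Nonempty S] in
theorem exists_occupation_bound {X : MChain (ℕ × S)} (hirr : X.Irreducible) (s0 : S) {p : ℝ}
    (hp : 1 < p) (hB : CondB X p) {Q : S → S → ℝ} {pst : S → ℝ} (hQ : CondQ X Q)
    (hpst : IsStationaryDist Q pst) :
    ∃ K : ℝ, 0 ≤ K ∧ ∀ (x : ℕ) (r : ℝ), 1 ≤ x → 0 ≤ r →
      (∀ y : ℕ, x ≤ 2 * y → ∀ l j, |qhat X y l j - Q l j| ≤ r) → ∀ i,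
      |(∫ ω, (∑ k ∈ Finset.range (tauRet s0 ω), if (ω k).2 = i then (1:ℝ) else 0)
          ∂(X.P (x, s0))) - pst i / pst s0| ≤ K * (r + (x : ℝ) ^ (-(1 / 2) : ℝ)) := by
  obtain ⟨C, ρ, hC0, hρ0, hρ1, hgeo⟩ := exists_prob_avoidUpTo_le hirr hp hB hQ s0
  obtain ⟨D, hD0, hlow⟩ := hB.exists_prob_low_le hp
  obtain ⟨K, hK0, hK⟩ := hQ.2.2.exists_abs_le hQ.2.1 s0
  set b : ℕ → ℝ := fun k => C * ρ ^ k + √(D * C) * ((k : ℝ) ^ 1 * √ρ ^ k) with hb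
  have hbs : Summable b := summable_geometric_add_linear_mul_geometric hρ0 hρ1 C √(D * C)
  have hb0 : ∀ k, 0 ≤ b k := fun k => by positivity
  refine ⟨K * ∑' k, b k, mul_nonneg hK0.le (tsum_nonneg hb0), fun x r hx hr0 hr => ?_⟩
  have hx0 : (0 : ℝ) < x := by exact_mod_cast hx
  have hsum : Summable fun k => (X.P (x, s0)).real (avoidUpTo s0 k) :=
    ((summable_geometric_of_lt_one hρ0 hρ1).mul_left C).of_nonneg_of_le
      (fun _ => measureReal_nonneg) fun k => hgeo _ k
  set ν : S → ℝ := fun i =>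
    ∫ ω, (∑ k ∈ Finset.range (tauRet s0 ω), if (ω k).2 = i then (1:ℝ) else 0) ∂(X.P (x, s0))
  have hocc : ∀ i, HasSum (fun k => (X.P (x, s0)).real (avoidUpTo s0 k ∩ {ω | (ω k).2 = i}))
      (ν i) := hasSum_occupation X s0 (x, s0) hsum
  have hν0 : ν s0 = 1 := (hocc s0).unique (hasSum_visit_start X s0 x)
  have hterm : ∀ k, r * (X.P (x, s0)).real (avoidUpTo s0 k)
      + (X.P (x, s0)).real (avoidUpTo s0 k ∩ {ω | 2 * (ω k).1 < x})
      ≤ (r + (x : ℝ) ^ (-(1 / 2) : ℝ)) * b k := by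
    intro k
    set u := (X.P (x, s0)).real (avoidUpTo s0 k ∩ {ω | 2 * (ω k).1 < x})
    have hu0 : 0 ≤ u := measureReal_nonneg
    have hu1 : u ≤ C * ρ ^ k := (measureReal_mono Set.inter_subset_left).trans (hgeo _ k)
    have hu2 : u ≤ D * k / x := (measureReal_mono Set.inter_subset_right).trans (hlow x s0 k hx)
    have hu := le_rpow_neg_half_mul_geometric hC0 hD0 hρ0 hx0 hu0 hu1 hu2
    have h1 : r * (X.P (x, s0)).real (avoidUpTo s0 k) ≤ r * b k := by
      gcongr
      refine (hgeo _ k).trans (le_add_of_nonneg_right (by positivity))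
    have h2 : u ≤ (x : ℝ) ^ (-(1 / 2) : ℝ) * b k := by
      refine hu.trans ?_
      gcongr
      exact le_add_of_nonneg_left (by positivity)
    linarith
  have herr : ∀ j, |ν j - ∑ l, ν l * Q l j| ≤
      (∑' k, b k) * (r + (x : ℝ) ^ (-(1 / 2) : ℝ)) := by
    intro j
    have h := (hasSum_next X s0 x hsum j (hocc j)).sub
      (hasSum_sum fun l (_ : l ∈ Finset.univ) => (hocc l).mul_right (Q l j))
    have hle := fun k =>
      (abs_next_sub_sum_le X hQ.2.1 s0 (x, s0) k j x hr0 hr).trans (hterm k)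
    simp only [← Real.norm_eq_abs] at hle
    have h2 := tsum_of_norm_bounded (hbs.hasSum.mul_left _) hle
    rw [h.tsum_eq, mul_comm] at h2
    exact h2
  have hpos := hpst.1 s0
  intro i
  have hfin := hK (fun i => ν i - pst i / pst s0) _ (by rw [hν0, div_self hpos.ne', sub_self])
    (fun j => by
      have : ν j - pst j / pst s0 - ∑ l, (ν l - pst l / pst s0) * Q l j
          = ν j - ∑ l, ν l * Q l j := by
        simp only [sub_mul, Finset.sum_sub_distrib, div_mul_eq_mul_div, ← Finset.sum_div]
        rw [hpst.2.2 j]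
        ring
      rw [this]
      exact herr j) i
  rw [mul_assoc]
  exact hfin

/-- Lemma (occupation times): under (B_p) for some `p > 1` and (Q_∞), the mean occupation
time of line `i` during an excursion started from `(x, s0)` converges to `π(i)/π(s0)` as
`x → ∞`; under (Q_∞^+), with a power-law rate. -/
theorem stmt10 (X : MChain (ℕ × S)) (hirr : X.Irreducible) (s0 : S)
    (p : ℝ) (hp : 1 < p) (hB : CondB X p)
    (Q : S → S → ℝ) (pst : S → ℝ) (hQ : CondQ X Q) (hpst : IsStationaryDist Q pst) :
    (∀ i : S,
      Tendsto (fun x : ℕ =>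
          ∫ ω, (∑ k ∈ Finset.range (tauRet s0 ω), if (ω k).2 = i then (1:ℝ) else 0)
            ∂(X.P (x, s0)))
        atTop (nhds (pst i / pst s0))) ∧
    (CondQplus X Q → ∃ δ : ℝ, 0 < δ ∧ ∀ i : S,
      (fun x : ℕ =>
          (∫ ω, (∑ k ∈ Finset.range (tauRet s0 ω), if (ω k).2 = i then (1:ℝ) else 0)
            ∂(X.P (x, s0))) - pst i / pst s0)
        =O[atTop] fun x : ℕ => (x : ℝ) ^ (-δ)) := by
  obtain ⟨K, hK0, hK⟩ := exists_occupation_bound hirr s0 hp hB hQ hpst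
  refine ⟨fun i => ?_, fun hQp => ?_⟩
  · rw [Metric.tendsto_atTop']
    intro ε hε
    set r : ℝ := ε / (2 * (K + 1)) with hr
    have hr0 : 0 < r := by positivity
    have hev : ∀ᶠ y : ℕ in atTop, ∀ l j, |qhat X y l j - Q l j| ≤ r := by
      simp only [eventually_all]
      intro l j
      filter_upwards [(Metric.tendsto_nhds.1 (hQ.1 l j)) r hr0] with y hy
      rw [← Real.dist_eq]
      exact hy.le
    obtain ⟨y₀, hy₀⟩ := eventually_atTop.1 hev
    have hlim : Tendsto (fun x : ℕ => (x : ℝ) ^ (-(1 / 2) : ℝ)) atTop (𝓝 0) :=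
      (tendsto_rpow_neg_atTop (by norm_num)).comp tendsto_natCast_atTop_atTop
    obtain ⟨x₁, hx₁⟩ := eventually_atTop.1 (hlim.eventually_lt_const hr0)
    refine ⟨max (2 * y₀) x₁, fun x hx => ?_⟩
    have h1 : 2 * y₀ < x := (le_max_left _ _).trans_lt hx
    have h2 := hx₁ x ((le_max_right _ _).trans hx.le)
    rw [Real.dist_eq]
    refine (hK x r (by omega) hr0.le (fun y hy => hy₀ y (by omega)) i).trans_lt ?_
    calc K * (r + (x : ℝ) ^ (-(1 / 2) : ℝ)) ≤ K * (r + r) := by gcongr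
      _ < (K + 1) * (r + r) := by gcongr; linarith
      _ = ε := by rw [hr]; field_simp; ring
  · obtain ⟨⟨δ₀, hδ₀, hO⟩, -⟩ := hQp
    have hex : ∃ A : ℝ, 0 < A ∧ ∀ᶠ y : ℕ in atTop, ∀ l j,
        |qhat X y l j - Q l j| ≤ A * (y : ℝ) ^ (-δ₀) := by
      have hO' : (fun y : ℕ => fun w : S × S => qhat X y w.1 w.2 - Q w.1 w.2)
          =O[atTop] fun y : ℕ => (y : ℝ) ^ (-δ₀) := isBigO_pi.2 fun w => hO w.1 w.2
      obtain ⟨A, hA, hA'⟩ := hO'.exists_pos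
      refine ⟨A, hA, hA'.bound.mono fun y hy l j => ?_⟩
      rw [Real.norm_of_nonneg (Real.rpow_nonneg (Nat.cast_nonneg y) _)] at hy
      exact (norm_le_pi_norm (fun w : S × S => qhat X y w.1 w.2 - Q w.1 w.2) (l, j)).trans hy
    obtain ⟨A, hA0, hA⟩ := hex
    obtain ⟨y₀, hy₀⟩ := eventually_atTop.1 hA
    refine ⟨min δ₀ (1 / 2), lt_min hδ₀ (by norm_num), fun i => ?_⟩
    refine IsBigO.of_bound (K * (A * 2 ^ δ₀ + 1)) ?_
    filter_upwards [eventually_ge_atTop (max (2 * y₀) 1)] with x hx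
    have hx1 : 1 ≤ x := (le_max_right _ _).trans hx
    have hxy : 2 * y₀ ≤ x := (le_max_left _ _).trans hx
    have hx1' : (1 : ℝ) ≤ x := by exact_mod_cast hx1
    have hx0 : (0 : ℝ) < x := by linarith
    have hb := hK x (A * 2 ^ δ₀ * (x : ℝ) ^ (-δ₀)) hx1 (by positivity) (fun y hy l j => ?_) i
    · rw [Real.norm_eq_abs, Real.norm_of_nonneg (by positivity)]
      refine hb.trans ?_
      have e1 : (x : ℝ) ^ (-δ₀) ≤ (x : ℝ) ^ (-min δ₀ (1 / 2)) :=
        Real.rpow_le_rpow_of_exponent_le hx1' (neg_le_neg (min_le_left _ _))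
      have e2 : (x : ℝ) ^ (-(1 / 2) : ℝ) ≤ (x : ℝ) ^ (-min δ₀ (1 / 2)) :=
        Real.rpow_le_rpow_of_exponent_le hx1' (neg_le_neg (min_le_right _ _))
      calc K * (A * 2 ^ δ₀ * (x : ℝ) ^ (-δ₀) + (x : ℝ) ^ (-(1 / 2) : ℝ))
          ≤ K * (A * 2 ^ δ₀ * (x : ℝ) ^ (-min δ₀ (1 / 2)) + (x : ℝ) ^ (-min δ₀ (1 / 2))) := by
            gcongr
        _ = _ := by ring
    · refine (hy₀ y (by omega) l j).trans ?_
      have hxy' : (x : ℝ) / 2 ≤ y := by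
        have : (x : ℝ) ≤ 2 * y := by exact_mod_cast hy
        linarith
      have h1 : (y : ℝ) ^ (-δ₀) ≤ ((x : ℝ) / 2) ^ (-δ₀) :=
        Real.rpow_le_rpow_of_nonpos (by positivity) hxy' (by linarith)
      have h2 : ((x : ℝ) / 2) ^ (-δ₀) = 2 ^ δ₀ * (x : ℝ) ^ (-δ₀) := by
        rw [Real.div_rpow hx0.le zero_le_two, Real.rpow_neg zero_le_two, div_inv_eq_mul, mul_comm]
      rw [mul_assoc, ← h2]
      gcongr
end
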